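/- Let d ≥ 3 and let B = ℂ[x,y,z]/(xy − z^d). If d is odd, then the ℝ-algebras ℝ[x,y,z]/(x² + y² − z^d) and ℝ[x,y,z]/(x² − y² − z^d) are non-isomorphic real forms of B and every real form of B is isomorphic to one of them (exactly 2 classes). If d is even, then the ℝ-algebras ℝ[x,y,z]/(x² + y² + z^d), ℝ[x,y,z]/(x² + y² − z^d) and ℝ[x,y,z]/(x² − y² − z^d) are pairwise non-isomorphic real forms of B and every real form of B is isomorphic to one of them (exactly 3 classes). -/

import Mathlib

open MvPolynomial
open scoped TensorProduct

/-- `A` is a real form of the complex algebra `B` if the complexification `ℂ ⊗[ℝ] A`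
is isomorphic to `B` as a `ℂ`-algebra. -/
def IsRealForm (A : Type) [CommRing A] [Algebra ℝ A]
    (B : Type) [CommRing B] [Algebra ℂ B] : Prop :=
  Nonempty ((ℂ ⊗[ℝ] A) ≃ₐ[ℂ] B)

/-- The real surfaces `x² + y² + z^d = 0`, `x² + y² - z^d = 0`, `x² - y² - z^d = 0`. -/
noncomputable def surf9 (d : ℕ) : Fin 3 → MvPolynomial (Fin 3) ℝ :=
  ![X 0 ^ 2 + X 1 ^ 2 + X 2 ^ d,
    X 0 ^ 2 + X 1 ^ 2 - X 2 ^ d,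
    X 0 ^ 2 - X 1 ^ 2 - X 2 ^ d]

namespace RF

abbrev R2 := MvPolynomial (Fin 2) ℂ

abbrev BB (d : ℕ) := MvPolynomial (Fin 3) ℂ ⧸
            Ideal.span {(X 0 * X 1 : MvPolynomial (Fin 3) ℂ) - X 2 ^ d}

noncomputable def bb (d : ℕ) (i : Fin 3) : BB d := Ideal.Quotient.mk _ (X i)

lemma bb_rel (d : ℕ) : bb d 0 * bb d 1 = bb d 2 ^ d := by
  unfold bb
  rw [← map_mul, ← map_pow, Ideal.Quotient.eq]
  exact Ideal.subset_span rfl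

noncomputable def iota (d : ℕ) : BB d →ₐ[ℂ] R2 :=
  Ideal.Quotient.liftₐ _ (aeval ![X 0 ^ d, X 1 ^ d, X 0 * X 1]) (by
    intro a ha
    have : Ideal.span {(X 0 * X 1 : MvPolynomial (Fin 3) ℂ) - X 2 ^ d} ≤
        RingHom.ker (aeval (R := ℂ) ![(X 0 : R2) ^ d, X 1 ^ d, X 0 * X 1]) := by
      rw [Ideal.span_le]
      rintro _ rfl
      simp [mul_pow]
    exact this ha)

@[simp] lemma iota_0 (d : ℕ) : iota d (bb d 0) = X 0 ^ d := by
  show aeval (R := ℂ) ![(X 0 : R2) ^ d, X 1 ^ d, X 0 * X 1] (X 0) = _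
  simp
@[simp] lemma iota_1 (d : ℕ) : iota d (bb d 1) = X 1 ^ d := by
  show aeval (R := ℂ) ![(X 0 : R2) ^ d, X 1 ^ d, X 0 * X 1] (X 1) = _
  simp
@[simp] lemma iota_2 (d : ℕ) : iota d (bb d 2) = X 0 * X 1 := by
  show aeval (R := ℂ) ![(X 0 : R2) ^ d, X 1 ^ d, X 0 * X 1] (X 2) = _
  simp

lemma bb_mk (d : ℕ) (p : MvPolynomial (Fin 3) ℂ) :
    (Ideal.Quotient.mk (Ideal.span {(X 0 * X 1 : MvPolynomial (Fin 3) ℂ) - X 2 ^ d}) p) = aeval (bb d) p := by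
  induction p using MvPolynomial.induction_on with
  | C a => simp only [aeval_C]; rfl
  | add p q hp hq => simp only [map_add, hp, hq]
  | mul_X p i hp => simp only [map_mul, hp, aeval_X]; rfl

/-- normal form -/
noncomputable def nf (d : ℕ) (m : Fin 2 →₀ ℕ) : BB d :=
  if m 1 ≤ m 0 then bb d 0 ^ ((m 0 - m 1) / d) * bb d 2 ^ (m 1)
  else bb d 1 ^ ((m 1 - m 0) / d) * bb d 2 ^ (m 0)

noncomputable def sec (d : ℕ) : R2 →ₗ[ℂ] BB d := (basisMonomials (Fin 2) ℂ).constr ℂ (nf d)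

lemma sec_monomial (d : ℕ) (m : Fin 2 →₀ ℕ) (c : ℂ) : sec d (monomial m c) = c • nf d m := by
  have : (monomial m c : R2) = c • basisMonomials (Fin 2) ℂ m := by
    simp [smul_monomial]
  rw [this, map_smul, sec, Module.Basis.constr_basis]

lemma R2_monomial (i j : ℕ) : (X 0 ^ i * X 1 ^ j : R2) = monomial (Finsupp.single 0 i + Finsupp.single 1 j) 1 := by
  rw [X_pow_eq_monomial, X_pow_eq_monomial, monomial_mul, one_mul]

lemma monomial_R2 (m : Fin 2 →₀ ℕ) (c : ℂ) : (monomial m c : R2) = C c * (X 0 ^ (m 0) * X 1 ^ (m 1)) := by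
  rw [monomial_eq, Finsupp.prod_fintype _ _ (by simp)]
  simp [Fin.prod_univ_two]

lemma sec_iota (d : ℕ) (hd : 0 < d) (b : BB d) : sec d (iota d b) = b := by
  obtain ⟨p, rfl⟩ := Ideal.Quotient.mk_surjective b
  rw [bb_mk]
  induction p using MvPolynomial.induction_on' with
  | add p q hp hq => simp only [map_add, hp, hq]
  | monomial m c =>
    rw [aeval_monomial, Finsupp.prod_fintype _ _ (by simp)]
    simp only [Fin.prod_univ_three]
    have : iota d ((algebraMap ℂ (BB d)) c * (bb d 0 ^ m 0 * bb d 1 ^ m 1 * bb d 2 ^ m 2))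
       = monomial (Finsupp.single 0 (d * m 0 + m 2) + Finsupp.single 1 (d * m 1 + m 2)) c := by
      have h2 : (monomial (Finsupp.single 0 (d * m 0 + m 2) + Finsupp.single 1 (d * m 1 + m 2)) c : R2)
        = C c * monomial (Finsupp.single 0 (d * m 0 + m 2) + Finsupp.single 1 (d * m 1 + m 2)) 1 := by
        rw [C_mul_monomial, mul_one]
      rw [h2, ← R2_monomial]
      simp only [map_mul, map_pow, iota_0, iota_1, iota_2, AlgHom.commutes]
      rw [MvPolynomial.algebraMap_eq]
      ring
    rw [this, sec_monomial]
    refine (Algebra.smul_def (A := BB d) c _).trans ?_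
    congr 1
    unfold nf
    simp only [Finsupp.add_apply, Finsupp.single_apply]
    simp only [Fin.isValue, one_ne_zero, ↓reduceIte, add_zero, zero_ne_one, zero_add]
    split_ifs with h
    · have h1 : m 1 ≤ m 0 := by
        have := Nat.le_of_add_le_add_right h
        exact Nat.le_of_mul_le_mul_left this hd
      have h2 : (d * m 0 + m 2 - (d * m 1 + m 2)) / d = m 0 - m 1 := by
        rw [Nat.add_sub_add_right, ← Nat.mul_sub, Nat.mul_div_cancel_left _ hd]
      rw [h2, pow_add, pow_mul, ← bb_rel, mul_pow]
      obtain ⟨k, hk⟩ := Nat.exists_eq_add_of_le h1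
      rw [hk, Nat.add_sub_cancel_left, pow_add]; ring
    · have h1 : m 0 ≤ m 1 := by
        by_contra h'
        apply h
        have := Nat.mul_le_mul_left d (le_of_lt (not_le.mp h'))
        omega
      have h2 : (d * m 1 + m 2 - (d * m 0 + m 2)) / d = m 1 - m 0 := by
        rw [Nat.add_sub_add_right, ← Nat.mul_sub, Nat.mul_div_cancel_left _ hd]
      rw [h2, pow_add, pow_mul, ← bb_rel, mul_pow]
      obtain ⟨k, hk⟩ := Nat.exists_eq_add_of_le h1
      rw [hk, Nat.add_sub_cancel_left, pow_add]; ring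

lemma iota_inj (d : ℕ) (hd : 0 < d) : Function.Injective (iota d) :=
  Function.LeftInverse.injective (sec_iota d hd)

/-- diagonal substitution -/
noncomputable def dg (a b : ℂ) : R2 →ₐ[ℂ] R2 := aeval ![C a * X 0, C b * X 1]

@[simp] lemma dg_0 (a b : ℂ) : dg a b (X 0) = C a * X 0 := by simp [dg]
@[simp] lemma dg_1 (a b : ℂ) : dg a b (X 1) = C b * X 1 := by simp [dg]
@[simp] lemma dg_C (a b c : ℂ) : dg a b (C c) = C c := by simp [dg]

lemma dg_monomial (a b c : ℂ) (m : Fin 2 →₀ ℕ) : dg a b (monomial m c) = monomial m (a ^ m 0 * b ^ m 1 * c) := by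
  rw [monomial_R2, monomial_R2]
  simp only [map_mul, map_pow, dg_C, dg_0, dg_1]
  ring

lemma coeff_dg (a b : ℂ) (f : R2) (m : Fin 2 →₀ ℕ) : coeff m (dg a b f) = a ^ m 0 * b ^ m 1 * coeff m f := by
  induction f using MvPolynomial.induction_on' with
  | add p q hp hq => simp only [map_add, coeff_add, hp, hq]; ring
  | monomial n c =>
    rw [dg_monomial, coeff_monomial, coeff_monomial]
    split_ifs with h
    · rw [h]
    · simp

noncomputable abbrev De (ξ : ℂ) : R2 →ₐ[ℂ] R2 := dg ξ ξ⁻¹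

lemma De_iota (d : ℕ) (ξ : ℂ) (h : ξ ^ d = 1) (hd : 0 < d) (b : BB d) : De ξ (iota d b) = iota d b := by
  obtain ⟨p, rfl⟩ := Ideal.Quotient.mk_surjective b
  rw [bb_mk]
  have h0 : ξ ≠ 0 := by rintro rfl; simp [hd.ne'] at h
  induction p using MvPolynomial.induction_on with
  | C a => rw [aeval_C, AlgHom.commutes, AlgHom.commutes]
  | add p q hp hq => simp only [map_add, hp, hq]
  | mul_X p i hp =>
    simp only [map_mul, hp, aeval_X]
    congr 1
    fin_cases i
    · simp [mul_pow, ← C_pow, h]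
    · simp [mul_pow, ← C_pow, h]
    · simp only [Fin.reduceFinMk, iota_2, map_mul, dg_0, dg_1]
      rw [mul_mul_mul_comm, ← C_mul, mul_inv_cancel₀ h0]; simp

lemma mem_range_iota (d : ℕ) (hd : 0 < d) (r : R2) (h : ∀ ξ : ℂ, ξ ^ d = 1 → De ξ r = r) :
    r ∈ (iota d).range := by
  have hz := Complex.isPrimitiveRoot_exp d hd.ne'
  set ω := Complex.exp (2 * Real.pi * Complex.I / d)
  have h0 : ω ≠ 0 := Complex.exp_ne_zero _
  have hr := h ω hz.pow_eq_one
  rw [r.as_sum]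
  refine Subalgebra.sum_mem _ fun m hm => ?_
  have hc : coeff m r ≠ 0 := mem_support_iff.mp hm
  have h1 := coeff_dg ω ω⁻¹ r m
  rw [hr] at h1
  have h2 : ω ^ m 0 = ω ^ m 1 := by
    have : ω ^ m 0 * ω⁻¹ ^ m 1 = 1 := by
      apply mul_right_cancel₀ hc; rw [← h1, one_mul]
    rw [inv_pow] at this
    field_simp at this
    exact this
  rw [monomial_R2]
  refine Subalgebra.mul_mem _ (Subalgebra.algebraMap_mem _ _) ?_
  rcases le_total (m 1) (m 0) with hle | hle
  · obtain ⟨k, hk⟩ := Nat.exists_eq_add_of_le hle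
    rw [hk, pow_add] at h2
    have h3 : ω ^ k = 1 := mul_left_cancel₀ (pow_ne_zero _ h0) (h2.trans (mul_one _).symm)
    obtain ⟨e, rfl⟩ := (hz.pow_eq_one_iff_dvd k).mp h3
    refine ⟨bb d 0 ^ e * bb d 2 ^ m 1, ?_⟩
    simp only [AlgHom.toRingHom_eq_coe, RingHom.coe_coe, map_mul, map_pow, iota_0, iota_2, hk]; ring
  · obtain ⟨k, hk⟩ := Nat.exists_eq_add_of_le hle
    rw [hk, pow_add] at h2
    have h3 : ω ^ k = 1 := mul_left_cancel₀ (pow_ne_zero _ h0) (h2.symm.trans (mul_one _).symm)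
    obtain ⟨e, rfl⟩ := (hz.pow_eq_one_iff_dvd k).mp h3
    refine ⟨bb d 1 ^ e * bb d 2 ^ m 0, ?_⟩
    simp only [AlgHom.toRingHom_eq_coe, RingHom.coe_coe, map_mul, map_pow, iota_1, iota_2, hk]; ring

/-- Jacobian -/
noncomputable def Jac (f g : R2) : R2 := pderiv 0 f * pderiv 1 g - pderiv 1 f * pderiv 0 g

lemma chain (φ : R2 →+* R2) (τ : ℂ → ℂ) (hφ : ∀ a, φ (C a) = C (τ a)) (i : Fin 2) (f : R2) :
    pderiv i (φ f) = φ (pderiv 0 f) * pderiv i (φ (X 0)) + φ (pderiv 1 f) * pderiv i (φ (X 1)) := by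
  induction f using MvPolynomial.induction_on with
  | C a => simp [hφ]
  | add p q hp hq => simp only [map_add, hp, hq]; ring
  | mul_X p j hp =>
    simp only [map_mul, Derivation.leibniz, hp, smul_eq_mul, map_add, pderiv_X]
    fin_cases j
    · simp; ring
    · simp; ring

lemma Jac_comp (φ : R2 →+* R2) (τ : ℂ → ℂ) (hφ : ∀ a, φ (C a) = C (τ a)) (f g : R2) :
    Jac (φ f) (φ g) = φ (Jac f g) * Jac (φ (X 0)) (φ (X 1)) := by
  unfold Jac
  rw [chain φ τ hφ 0 f, chain φ τ hφ 1 f, chain φ τ hφ 0 g, chain φ τ hφ 1 g]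
  simp only [map_sub, map_mul]; ring

/-- If phi hits nonzero multiples of both variables then its Jacobian is a nonzero constant. -/
lemma Jac_unit (φ : R2 →+* R2) (τ : ℂ → ℂ) (hφ : ∀ a, φ (C a) = C (τ a)) (f g : R2) (a b : ℂ)
    (ha : a ≠ 0) (hb : b ≠ 0) (hf : φ f = C a * X 0) (hg : φ g = C b * X 1) :
    ∃ c : ℂ, c ≠ 0 ∧ Jac (φ (X 0)) (φ (X 1)) = C c := by
  have h := Jac_comp φ τ hφ f g
  have h2 : Jac (φ f) (φ g) = C (a * b) := by
    rw [hf, hg]; simp [Jac, Derivation.leibniz, pderiv_X]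
  rw [h2] at h
  have hu : IsUnit (Jac (φ (X 0)) (φ (X 1))) := by
    apply isUnit_of_dvd_unit (Dvd.intro_left _ h.symm)
    exact (IsUnit.mk0 _ (mul_ne_zero ha hb)).map C
  rw [MvPolynomial.isUnit_iff_eq_C_of_isReduced] at hu
  obtain ⟨r, hr, h⟩ := hu
  exact ⟨r, hr.ne_zero, h⟩

end RF

namespace RF

lemma isUnit_of_dvd_both (d : ℕ) (hd : 0 < d) (c1 c2 : ℂ) (p : R2) (h0 : p ∣ X 0 ^ d - C c1) (h1 : p ∣ X 1 ^ d - C c2) :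
    IsUnit p := by
  have gen : ∀ (i j : Fin 2) (c : ℂ), i ≠ j → p ∣ X i ^ d - C c → degreeOf j p = 0 := by
    intro i j c hij hp
    obtain ⟨q, hq⟩ := hp
    have hne : (X i ^ d - C c : R2) ≠ 0 := by
      intro h
      have := congrArg (degreeOf i) (sub_eq_zero.mp h)
      rw [degreeOf_X_self_pow, degreeOf_C] at this
      omega
    rw [hq] at hne
    have h2 := congrArg (degreeOf j) hq
    rw [degreeOf_mul_eq (left_ne_zero_of_mul hne) (right_ne_zero_of_mul hne)] at h2
    have h3 := degreeOf_sub_le j (X i ^ d : R2) (C c)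
    rw [degreeOf_X_pow_of_ne _ hij.symm, degreeOf_C] at h3
    simp at h3
    omega
  have e1 := gen 0 1 c1 (by simp) h0
  have e0 := gen 1 0 c2 (by simp) h1
  have hC : p = C (coeff 0 p) := by
    rw [← totalDegree_eq_zero_iff_eq_C, totalDegree_eq_zero_iff]
    intro m hm x
    have := monomial_le_degreeOf x hm
    fin_cases x <;> simp_all
  have hp0 : coeff 0 p ≠ 0 := by
    intro h
    rw [h, C_0] at hC
    rw [hC, zero_dvd_iff] at h0
    have := congrArg (degreeOf 0) (sub_eq_zero.mp h0)
    rw [degreeOf_X_self_pow, degreeOf_C] at this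
    omega
  rw [hC]
  exact (IsUnit.mk0 _ hp0).map C

/-- B is constants plus the maximal ideal of the singular point -/
lemma decomp (d : ℕ) (b : BB d) : ∃ (c : ℂ) (p q r : BB d), b = algebraMap ℂ _ c + p * bb d 0 + q * bb d 1 + r * bb d 2 := by
  obtain ⟨p, rfl⟩ := Ideal.Quotient.mk_surjective b
  rw [bb_mk]
  induction p using MvPolynomial.induction_on with
  | C a => exact ⟨a, 0, 0, 0, by simp⟩
  | add p q hp hq =>
    obtain ⟨c, x, y, z, h⟩ := hp
    obtain ⟨c', x', y', z', h'⟩ := hq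
    exact ⟨c + c', x + x', y + y', z + z', by simp only [map_add, h, h']; ring⟩
  | mul_X p i hp =>
    fin_cases i
    · exact ⟨0, aeval (bb d) p, 0, 0, by simp⟩
    · exact ⟨0, 0, aeval (bb d) p, 0, by simp⟩
    · exact ⟨0, 0, 0, aeval (bb d) p, by simp⟩

lemma eq_root_mul {d : ℕ} (hd : 0 < d) {f g : R2} (h : f ^ d = g ^ d) : ∃ ζ : ℂ, ζ ^ d = 1 ∧ f = C ζ * g := by
  have hz := (Complex.isPrimitiveRoot_exp d hd.ne').map_of_injective (f := (C : ℂ →+* R2)) (C_injective _ _)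
  have h2 := hz.pow_sub_pow_eq_prod_sub_mul f g hd
  rw [h, sub_self, eq_comm, Finset.prod_eq_zero_iff] at h2
  obtain ⟨r, hr, h3⟩ := h2
  rw [Polynomial.mem_nthRootsFinset hd] at hr
  obtain ⟨ζ, hζ, h4⟩ := (MvPolynomial.isUnit_iff_eq_C_of_isReduced).mp (IsUnit.of_pow_eq_one hr hd.ne')
  refine ⟨ζ, ?_, ?_⟩
  · apply C_injective (Fin 2) ℂ
    rw [C_pow, ← h4, hr, C_1]
  · rw [← h4, sub_eq_zero.mp h3]

lemma lift0 (d : ℕ) (hd : 0 < d) (α : BB d ≃+* BB d) (τ : ℂ → ℂ)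
    (hα : ∀ c, α (algebraMap ℂ _ c) = algebraMap ℂ _ (τ c)) :
    ∃ U V : R2, iota d (α (bb d 0)) = U ^ d ∧ iota d (α (bb d 1)) = V ^ d ∧ iota d (α (bb d 2)) = U * V := by
  classical
  let _ : NormalizedGCDMonoid R2 := Classical.choice inferInstance
  set f := iota d (α (bb d 0)) with hf
  set g := iota d (α (bb d 1)) with hg
  set h := iota d (α (bb d 2)) with hh
  have hfg : f * g = h ^ d := by
    rw [hf, hg, hh, ← map_mul, ← map_mul, ← map_pow, ← map_pow, bb_rel]
  have key : ∀ p : R2, Irreducible p → p ∣ f → p ∣ g → False := by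
    intro p hp pf pg
    have ph : p ∣ h := hp.prime.dvd_of_dvd_pow (hfg ▸ pf.mul_right g)
    have : ∀ b : BB d, ∃ c : ℂ, p ∣ iota d b - C c := by
      intro b
      obtain ⟨c, x, y, z, hb⟩ := decomp d (α.symm b)
      refine ⟨τ c, ?_⟩
      have : b = α (α.symm b) := by simp
      rw [this, hb]
      simp only [map_add, map_mul, hα, AlgHom.commutes, algebraMap_eq]
      rw [← hf, ← hg, ← hh]
      have e : C (τ c) + (iota d) (α x) * f + (iota d) (α y) * g + (iota d) (α z) * h - C (τ c)
        = (iota d) (α x) * f + (iota d) (α y) * g + (iota d) (α z) * h := by ring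
      rw [e]
      exact dvd_add (dvd_add (pf.mul_left _) (pg.mul_left _)) (ph.mul_left _)
    obtain ⟨c1, h1⟩ := this (bb d 0)
    obtain ⟨c2, h2⟩ := this (bb d 1)
    rw [iota_0] at h1
    rw [iota_1] at h2
    exact hp.not_isUnit (isUnit_of_dvd_both d hd c1 c2 p h1 h2)
  have hf0 : f ≠ 0 := by
    intro h0
    rw [hf, ← map_zero (iota d), (iota_inj d hd).eq_iff] at h0
    have : bb d 0 = 0 := by simpa using h0
    have h2 := iota_0 d
    rw [this, map_zero] at h2
    exact pow_ne_zero _ (X_ne_zero _) h2.symm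
  have hgcd : IsUnit (gcd f g) := by
    by_contra hn
    obtain ⟨p, hp, hpd⟩ := WfDvdMonoid.exists_irreducible_factor hn (by simp [gcd_eq_zero_iff, hf0])
    exact key p hp (hpd.trans (gcd_dvd_left _ _)) (hpd.trans (gcd_dvd_right _ _))
  have hpow : ∀ f g : R2, IsUnit (gcd f g) → f * g = h ^ d → ∃ U, f = U ^ d := by
    intro f g hu hfg
    obtain ⟨U, u, hU⟩ := exists_associated_pow_of_mul_eq_pow hu hfg
    obtain ⟨r, hr, hu'⟩ := (MvPolynomial.isUnit_iff_eq_C_of_isReduced).mp u.isUnit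
    obtain ⟨s, hs⟩ := IsAlgClosed.exists_pow_nat_eq r hd
    refine ⟨C s * U, ?_⟩
    rw [← hU, hu', mul_pow, ← C_pow, hs, mul_comm]
  obtain ⟨U, hU⟩ := hpow f g hgcd hfg
  have hgcd' : IsUnit (gcd g f) := by
    rwa [gcd_comm]
  obtain ⟨V, hV⟩ := hpow g f hgcd' (by rw [mul_comm, hfg])
  have : h ^ d = (U * V) ^ d := by rw [mul_pow, ← hU, ← hV, hfg]
  obtain ⟨ζ, hζ, he⟩ := eq_root_mul hd this
  refine ⟨U, C ζ * V, hU, ?_, ?_⟩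
  · rw [mul_pow, ← C_pow, hζ, hV]; simp
  · rw [he]; ring

def Cls (d : ℕ) (U V : R2) : Prop :=
  (∀ ξ : ℂ, ξ ^ d = 1 → De ξ U = C ξ * U ∧ De ξ V = C ξ⁻¹ * V) ∨
  (∀ ξ : ℂ, ξ ^ d = 1 → De ξ U = C ξ⁻¹ * U ∧ De ξ V = C ξ * V)

lemma ext_BB {d : ℕ} {S : Type*} [CommRing S] (f g : BB d →+* S)
    (hc : ∀ c : ℂ, f (algebraMap ℂ _ c) = g (algebraMap ℂ _ c)) (h : ∀ i, f (bb d i) = g (bb d i)) (b : BB d) :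
    f b = g b := by
  obtain ⟨p, rfl⟩ := Ideal.Quotient.mk_surjective b
  rw [bb_mk]
  induction p using MvPolynomial.induction_on with
  | C a => rw [aeval_C]; exact hc a
  | add p q hp hq => simp only [map_add, hp, hq]
  | mul_X p i hp => simp only [map_mul, hp, aeval_X, h]

lemma lift1 (d : ℕ) (hd : 0 < d) (α : BB d ≃+* BB d) (τ : ℂ →+* ℂ)
    (hα : ∀ c, α (algebraMap ℂ _ c) = algebraMap ℂ _ (τ c)) :
    ∃ φ : R2 →+* R2, (∀ c, φ (C c) = C (τ c)) ∧ (∀ b, φ (iota d b) = iota d (α b)) := by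
  obtain ⟨U, V, h0, h1, h2⟩ := lift0 d hd α τ hα
  refine ⟨eval₂Hom (C.comp τ) ![U, V], by simp, ?_⟩
  intro b
  refine ext_BB ((eval₂Hom (C.comp τ) ![U, V]).comp (iota d : BB d →+* R2))
    ((iota d : BB d →+* R2).comp (α : BB d →+* BB d)) ?_ ?_ b
  · intro c
    simp [hα, algebraMap_eq]
  · intro i
    fin_cases i
    · simp [h0]
    · simp [h1]
    · simp [h2]

lemma lift_id (d : ℕ) (hd : 0 < d) (φ : R2 →+* R2) (hb : ∀ b, φ (iota d b) = iota d b) :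
    ∃ ζ : ℂ, ζ ^ d = 1 ∧ φ (X 0) = C ζ * X 0 ∧ φ (X 1) = C ζ⁻¹ * X 1 := by
  have h0 := hb (bb d 0)
  have h1 := hb (bb d 1)
  have h2 := hb (bb d 2)
  rw [iota_0, map_pow] at h0
  rw [iota_1, map_pow] at h1
  rw [iota_2, map_mul] at h2
  obtain ⟨ζ, hζ, e0⟩ := eq_root_mul hd h0
  obtain ⟨ζ', hζ', e1⟩ := eq_root_mul hd h1
  refine ⟨ζ, hζ, e0, ?_⟩
  rw [e0, e1, mul_mul_mul_comm, ← C_mul] at h2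
  have h3 : C (ζ * ζ') = (C 1 : R2) := by
    apply mul_right_cancel₀ (mul_ne_zero (X_ne_zero (0 : Fin 2)) (X_ne_zero (1 : Fin 2)) : (X 0 * X 1 : R2) ≠ 0)
    rw [h2]; simp
  have h4 := C_injective _ _ h3
  rw [e1, eq_inv_of_mul_eq_one_right h4]

set_option maxHeartbeats 1000000 in
lemma lift (d : ℕ) (hd : 0 < d) (α : BB d ≃+* BB d) (τ : ℂ ≃+* ℂ)
    (hα : ∀ c, α (algebraMap ℂ _ c) = algebraMap ℂ _ (τ c)) :
    ∃ φ : R2 →+* R2, (∀ c, φ (C c) = C (τ c)) ∧ (∀ b, φ (iota d b) = iota d (α b)) ∧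
      Cls d (φ (X 0)) (φ (X 1)) := by
  obtain ⟨φ, hc, hφ⟩ := lift1 d hd α τ hα
  obtain ⟨φ', hc', hφ'⟩ := lift1 d hd α.symm τ.symm (by
    intro c
    rw [RingEquiv.symm_apply_eq, hα]; simp)
  refine ⟨φ, hc, hφ, ?_⟩
  obtain ⟨ζ, hζ, e0, e1⟩ := lift_id d hd (φ.comp φ') (by intro b; simp [hφ, hφ'])
  have hζ0 : ζ ≠ 0 := by rintro rfl; simp [hd.ne'] at hζ
  obtain ⟨c, hc0, hJ⟩ := Jac_unit φ τ hc (φ' (X 0)) (φ' (X 1)) ζ ζ⁻¹ hζ0 (inv_ne_zero hζ0) e0 e1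
  have hlin : coeff (Finsupp.single 0 1) (φ (X 0)) ≠ 0 ∨ coeff (Finsupp.single 1 1) (φ (X 0)) ≠ 0 := by
    by_contra hcon
    push Not at hcon
    have h := congrArg (coeff 0) hJ
    unfold Jac at h
    rw [coeff_sub, coeff_zero_C, ← constantCoeff_eq, map_mul, map_mul] at h
    simp only [constantCoeff_eq, coeff_pderiv, zero_add, hcon] at h
    simp at h
    exact hc0 h.symm
  have hU0 : φ (X 0) ≠ 0 := by
    intro h; simp [h] at hlin
  have main : ∀ ξ : ℂ, ξ ^ d = 1 → ∃ χ : ℂ, χ ≠ 0 ∧ De ξ (φ (X 0)) = C χ * φ (X 0) ∧ De ξ (φ (X 1)) = C χ⁻¹ * φ (X 1) := by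
    intro ξ hξ
    have h0 : De ξ (φ (X 0)) ^ d = (φ (X 0)) ^ d := by
      rw [← map_pow, ← map_pow, ← iota_0, hφ, De_iota d ξ hξ hd]
    have h2 : De ξ (φ (X 0)) * De ξ (φ (X 1)) = (φ (X 0)) * φ (X 1) := by
      rw [← map_mul, ← map_mul, ← iota_2 d, hφ, De_iota d ξ hξ hd]
    obtain ⟨χ, hχ, e⟩ := eq_root_mul hd h0
    have hχ0 : χ ≠ 0 := by rintro rfl; simp [hd.ne'] at hχ
    refine ⟨χ, hχ0, e, ?_⟩
    rw [e] at h2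
    apply mul_left_cancel₀ hU0
    calc _ = C χ⁻¹ * (C χ * φ (X 0) * De ξ (φ (X 1))) := by
            rw [mul_assoc, ← mul_assoc (C χ⁻¹), ← C_mul, inv_mul_cancel₀ hχ0]; simp
      _ = _ := by rw [h2]; ring
  rcases hlin with h | h
  · left
    intro ξ hξ
    obtain ⟨χ, hχ, a, b⟩ := main ξ hξ
    have h3 := congrArg (coeff (Finsupp.single 0 1)) a
    rw [coeff_dg, coeff_C_mul] at h3
    have h4 := mul_right_cancel₀ h h3
    simp at h4
    subst h4; exact ⟨a, b⟩
  · right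
    intro ξ hξ
    obtain ⟨χ, hχ, a, b⟩ := main ξ hξ
    have h3 := congrArg (coeff (Finsupp.single 1 1)) a
    rw [coeff_dg, coeff_C_mul] at h3
    have h4 := mul_right_cancel₀ h h3
    simp at h4
    rw [← h4] at a b
    rw [inv_inv] at b
    exact ⟨a, b⟩
end RF

namespace RF

def wt (w0 w1 : ℝ) (m : Fin 2 →₀ ℕ) : ℝ := m 0 * w0 + m 1 * w1

lemma wt_add (w0 w1 : ℝ) (m n : Fin 2 →₀ ℕ) : wt w0 w1 (m + n) = wt w0 w1 m + wt w0 w1 n := by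
  simp [wt]; ring

def Sp (w0 w1 : ℝ) (s : Set ℝ) (f : R2) : Prop := ∀ m, coeff m f ≠ 0 → wt w0 w1 m ∈ s

section
variable {w0 w1 : ℝ}

lemma Sp.mono {s t : Set ℝ} (h : s ⊆ t) {f : R2} (hf : Sp w0 w1 s f) : Sp w0 w1 t f :=
  fun m hm => h (hf m hm)

lemma Sp.zero (s : Set ℝ) : Sp w0 w1 s 0 := fun m hm => by simp at hm

lemma Sp.add {s : Set ℝ} {f g : R2} (hf : Sp w0 w1 s f) (hg : Sp w0 w1 s g) : Sp w0 w1 s (f + g) := by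
  intro m hm
  rw [coeff_add] at hm
  by_cases h : coeff m f = 0
  · apply hg; intro h'; simp [h, h'] at hm
  · exact hf m h

lemma Sp.C_mul {s : Set ℝ} {f : R2} (c : ℂ) (hf : Sp w0 w1 s f) : Sp w0 w1 s (C c * f) := by
  intro m hm
  rw [coeff_C_mul] at hm
  exact hf m (right_ne_zero_of_mul hm)

lemma Sp.neg {s : Set ℝ} {f : R2} (hf : Sp w0 w1 s f) : Sp w0 w1 s (-f) := by
  intro m hm
  rw [coeff_neg, neg_ne_zero] at hm
  exact hf m hm

lemma Sp.sub {s : Set ℝ} {f g : R2} (hf : Sp w0 w1 s f) (hg : Sp w0 w1 s g) : Sp w0 w1 s (f - g) := by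
  rw [sub_eq_add_neg]; exact hf.add hg.neg

lemma Sp.mul {s t r : Set ℝ} (h : ∀ x ∈ s, ∀ y ∈ t, x + y ∈ r) {f g : R2} (hf : Sp w0 w1 s f) (hg : Sp w0 w1 t g) :
    Sp w0 w1 r (f * g) := by
  intro m hm
  have := support_mul f g (mem_support_iff.mpr hm)
  obtain ⟨a, ha, b, hb, rfl⟩ := Finset.mem_add.mp this
  rw [wt_add]
  exact h _ (hf a (mem_support_iff.mp ha)) _ (hg b (mem_support_iff.mp hb))

lemma Sp.sum {ι : Type*} {s : Set ℝ} (A : Finset ι) (f : ι → R2) (hf : ∀ i ∈ A, Sp w0 w1 s (f i)) :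
    Sp w0 w1 s (∑ i ∈ A, f i) := by
  classical
  induction A using Finset.induction_on with
  | empty => simpa using Sp.zero s
  | insert a A ha ih =>
    rw [Finset.sum_insert ha]
    exact (hf a (by simp)).add (ih fun i hi => hf i (by simp [hi]))

/-- f has leading form F of weight a -/
def Ld (w0 w1 a : ℝ) (f F : R2) : Prop := Sp w0 w1 {a} F ∧ Sp w0 w1 (Set.Iio a) (f - F)

lemma Ld.le {a : ℝ} {f F : R2} (h : Ld w0 w1 a f F) : Sp w0 w1 (Set.Iic a) f := by
  have : f = F + (f - F) := by ring
  rw [this]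
  exact (h.1.mono (by simp)).add (h.2.mono Set.Iio_subset_Iic_self)

lemma Ld.of_lt {a : ℝ} {f : R2} (h : Sp w0 w1 (Set.Iio a) f) : Ld w0 w1 a f 0 :=
  ⟨Sp.zero _, by simpa using h⟩

lemma Ld.lt {a : ℝ} {f : R2} (h : Ld w0 w1 a f 0) : Sp w0 w1 (Set.Iio a) f := by
  simpa using h.2

lemma Ld.of_eq {a : ℝ} {f : R2} (h : Sp w0 w1 {a} f) : Ld w0 w1 a f f :=
  ⟨h, by simpa using Sp.zero _⟩

lemma Ld.add {a : ℝ} {f F g G : R2} (h : Ld w0 w1 a f F) (h' : Ld w0 w1 a g G) : Ld w0 w1 a (f + g) (F + G) :=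
  ⟨h.1.add h'.1, by rw [add_sub_add_comm]; exact h.2.add h'.2⟩

lemma Ld.C_mul {a : ℝ} {f F : R2} (c : ℂ) (h : Ld w0 w1 a f F) : Ld w0 w1 a (C c * f) (C c * F) :=
  ⟨h.1.C_mul c, by rw [← mul_sub]; exact h.2.C_mul c⟩

lemma Ld.sub {a : ℝ} {f F g G : R2} (h : Ld w0 w1 a f F) (h' : Ld w0 w1 a g G) : Ld w0 w1 a (f - g) (F - G) :=
  ⟨h.1.sub h'.1, by rw [sub_sub_sub_comm]; exact h.2.sub h'.2⟩

lemma Ld.mul {a b : ℝ} {f F g G : R2} (h : Ld w0 w1 a f F) (h' : Ld w0 w1 b g G) : Ld w0 w1 (a + b) (f * g) (F * G) := by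
  refine ⟨h.1.mul ?_ h'.1, ?_⟩
  · rintro _ rfl _ rfl; rfl
  · have : f * g - F * G = f * (g - G) + (f - F) * G := by ring
    rw [this]
    refine (h.le.mul ?_ h'.2).add (h.2.mul ?_ h'.1)
    · intro x hx y hy; simp at *; linarith
    · rintro x hx _ rfl; simp at *; linarith

lemma Ld.one : Ld w0 w1 0 1 1 := by
  apply Ld.of_eq
  intro m hm
  rw [coeff_one] at hm
  have : m = 0 := by by_contra h; simp [Ne.symm h] at hm
  subst this
  simp [wt]

lemma Ld.pow {a : ℝ} {f F : R2} (h : Ld w0 w1 a f F) (n : ℕ) : Ld w0 w1 (n * a) (f ^ n) (F ^ n) := by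
  induction n with
  | zero => simpa using Ld.one
  | succ n ih =>
    rw [pow_succ, pow_succ]
    have : ((n + 1 : ℕ) : ℝ) * a = n * a + a := by push_cast; ring
    rw [this]
    exact ih.mul h

lemma Ld.sum {ι : Type*} {a : ℝ} (A : Finset ι) (f F : ι → R2) (hf : ∀ i ∈ A, Ld w0 w1 a (f i) (F i)) :
    Ld w0 w1 a (∑ i ∈ A, f i) (∑ i ∈ A, F i) :=
  ⟨Sp.sum _ _ fun i hi => (hf i hi).1, by rw [← Finset.sum_sub_distrib]; exact Sp.sum _ _ fun i hi => (hf i hi).2⟩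

lemma Ld.bound {a b : ℝ} {f F : R2} (h : Ld w0 w1 a f F) (hF : F ≠ 0) (hb : Sp w0 w1 (Set.Iic b) f) : a ≤ b := by
  obtain ⟨m, hm⟩ := ne_zero_iff.mp hF
  have h1 : wt w0 w1 m = a := h.1 m hm
  by_cases h2 : coeff m f = 0
  · have h3 : coeff m (f - F) ≠ 0 := by rw [coeff_sub, h2]; simpa using hm
    have := h.2 m h3
    simp [h1] at this
  · have := hb m h2
    rw [h1] at this; exact this

lemma Ld.coeff {a : ℝ} {f F : R2} (h : Ld w0 w1 a f F) {m : Fin 2 →₀ ℕ} (hm : wt w0 w1 m = a) :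
    coeff m F = coeff m f := by
  by_contra hne
  have h3 : MvPolynomial.coeff m (f - F) ≠ 0 := by
    rw [coeff_sub]; intro h; exact hne (sub_eq_zero.mp h).symm
  have := h.2 m h3
  simp [hm] at this

lemma Ld.ex {a : ℝ} {f : R2} (h : Sp w0 w1 (Set.Iic a) f) : ∃ F, Ld w0 w1 a f F := by
  classical
  let F : R2 := ∑ m ∈ f.support.filter (fun m => wt w0 w1 m = a), monomial m (MvPolynomial.coeff m f)
  have hF : ∀ m, MvPolynomial.coeff m F = if wt w0 w1 m = a then MvPolynomial.coeff m f else 0 := by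
    intro m
    simp only [F, coeff_sum, coeff_monomial, Finset.sum_ite_eq', Finset.mem_filter, mem_support_iff]
    split_ifs <;> simp_all
  refine ⟨F, ?_, ?_⟩
  · intro m hm
    rw [hF] at hm
    by_contra h'
    have : ¬ (wt w0 w1 m = a) := h'
    simp [this] at hm
  · intro m hm
    rw [coeff_sub, hF] at hm
    split_ifs at hm with h'
    · simp at hm
    · rw [sub_zero] at hm
      exact lt_of_le_of_ne (h m hm) h'

lemma Sp.pderiv0 {a : ℝ} {f : R2} (h : Sp w0 w1 (Set.Iic a) f) : Sp w0 w1 (Set.Iic (a - w0)) (pderiv 0 f) := by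
  intro m hm
  rw [coeff_pderiv] at hm
  have h2 := h _ (left_ne_zero_of_mul hm)
  rw [wt_add] at h2
  simp [wt] at h2 ⊢
  linarith

lemma Sp.pderiv1 {a : ℝ} {f : R2} (h : Sp w0 w1 (Set.Iic a) f) : Sp w0 w1 (Set.Iic (a - w1)) (pderiv 1 f) := by
  intro m hm
  rw [coeff_pderiv] at hm
  have h2 := h _ (left_ne_zero_of_mul hm)
  rw [wt_add] at h2
  simp [wt] at h2 ⊢
  linarith

lemma Sp.mul_le {a b : ℝ} {f g : R2} (hf : Sp w0 w1 (Set.Iic a) f) (hg : Sp w0 w1 (Set.Iic b) g) :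
    Sp w0 w1 (Set.Iic (a + b)) (f * g) :=
  hf.mul (fun x hx y hy => by simp at *; linarith) hg

lemma Sp.jac {a b : ℝ} {f g : R2} (hf : Sp w0 w1 (Set.Iic a) f) (hg : Sp w0 w1 (Set.Iic b) g) :
    Sp w0 w1 (Set.Iic (a + b - w0 - w1)) (Jac f g) := by
  unfold Jac
  refine Sp.sub ((hf.pderiv0.mul_le hg.pderiv1).mono ?_) ((hf.pderiv1.mul_le hg.pderiv0).mono ?_)
  · intro x hx; simp at *; linarith
  · intro x hx; simp at *; linarith

end

/-- substitution of leading forms -/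
lemma Ld.subst {w0 w1 v0 v1 l : ℝ} (hl : 0 < l) (φ φb : R2 →+* R2) (τ : ℂ → ℂ) (h : ∀ c, φ (C c) = C (τ c))
    (hb : ∀ c, φb (C c) = C (τ c)) (h0 : Ld w0 w1 (l * v0) (φ (X 0)) (φb (X 0)))
    (h1 : Ld w0 w1 (l * v1) (φ (X 1)) (φb (X 1))) {e : ℝ} {P Q : R2} (hP : Ld v0 v1 e P Q) :
    Ld w0 w1 (l * e) (φ P) (φb Q) := by
  have mono : ∀ (m : Fin 2 →₀ ℕ) (c : ℂ), Ld w0 w1 (l * wt v0 v1 m) (φ (monomial m c)) (φb (monomial m c)) := by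
    intro m c
    rw [monomial_R2]
    simp only [map_mul, map_pow, h, hb]
    have := ((h0.pow (m 0)).mul (h1.pow (m 1))).C_mul (τ c)
    convert this using 1
    unfold wt; ring
  have eqc : Ld w0 w1 (l * e) (φ Q) (φb Q) := by
    rw [Q.as_sum, map_sum, map_sum]
    refine Ld.sum _ _ _ fun m hm => ?_
    have : wt v0 v1 m = e := hP.1 m (mem_support_iff.mp hm)
    rw [← this]; exact mono m _
  have ltc : ∀ g : R2, Sp v0 v1 (Set.Iio e) g → Sp w0 w1 (Set.Iio (l * e)) (φ g) := by
    intro g hg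
    rw [g.as_sum, map_sum]
    refine Sp.sum _ _ fun m hm => ?_
    have : wt v0 v1 m < e := hg m (mem_support_iff.mp hm)
    refine (mono m _).le.mono ?_
    intro x hx
    simp at *
    exact lt_of_le_of_lt hx (mul_lt_mul_of_pos_left this hl)
  have : φ P = φ Q + φ (P - Q) := by rw [← map_add]; congr 1; ring
  rw [this]
  simpa using eqc.add (Ld.of_lt (ltc _ hP.2))

/-- Euler-type operator -/
noncomputable def En (n : ℕ) (f : R2) : R2 := X 1 * pderiv 1 f - C (n : ℂ) * f

lemma coeff_En (n : ℕ) (f : R2) (m : Fin 2 →₀ ℕ) : coeff m (En n f) = ((m 1 : ℂ) - n) * coeff m f := by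
  unfold En
  induction f using MvPolynomial.induction_on' with
  | add p q hp hq =>
    simp only [map_add, mul_add, coeff_add, coeff_sub, coeff_C_mul] at *
    linear_combination hp + hq
  | monomial k c =>
    rw [X_mul_pderiv_monomial, coeff_sub, coeff_C_mul, coeff_smul, coeff_monomial]
    split_ifs with h
    · subst h; simp; ring
    · simp

lemma Ld.En {w0 w1 a : ℝ} {f F : R2} (n : ℕ) (h : Ld w0 w1 a f F) : Ld w0 w1 a (En n f) (En n F) := by
  constructor
  · intro m hm
    rw [coeff_En] at hm
    exact h.1 m (right_ne_zero_of_mul hm)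
  · intro m hm
    rw [coeff_sub, coeff_En, coeff_En, ← mul_sub, ← coeff_sub] at hm
    exact h.2 m (right_ne_zero_of_mul hm)

lemma key_ineq {w0 w1 l : ℝ} (hw0 : 0 < w0) (hw1 : 0 < w1) (hl : 1 < l) (σ σb : R2 →+* R2) (τ : ℂ → ℂ)
    (hτ : ∀ c, c ≠ 0 → τ c ≠ 0)
    (h : ∀ c, σ (C c) = C (τ c)) (hb : ∀ c, σb (C c) = C (τ c))
    (h0 : Ld w0 w1 (l * w0) (σ (X 0)) (σb (X 0))) (h1 : Ld w0 w1 (l * w1) (σ (X 1)) (σb (X 1)))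
    (hU : σb (X 0) ≠ 0) (hV : σb (X 1) ≠ 0)
    (c : ℂ) (hc : c ≠ 0) (hJ : Jac (σ (X 0)) (σ (X 1)) = C c) (η : ℂ) (hη : σ (σ (X 0)) = C η * X 0) :
    w0 * (l + 1) ≤ (((σb (X 0)).support.card : ℝ) - 1) * (w0 + w1) := by
  classical
  obtain ⟨m, hm⟩ := ne_zero_iff.mp hU
  have step : ∀ J : Finset (Fin 2 →₀ ℕ), ∃ Q Qb : R2, Ld w0 w1 (l * w0) Q Qb ∧
      (∀ k, coeff k Qb = (∏ n ∈ J, ((k 1 : ℂ) - (n 1 : ℕ))) * coeff k (σb (X 0))) ∧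
      Sp w0 w1 (Set.Iic (w0 + J.card * ((l - 1) * (w0 + w1)))) (σ Q) := by
    intro J
    induction J using Finset.induction_on with
    | empty =>
      refine ⟨σ (X 0), σb (X 0), h0, by simp, ?_⟩
      rw [hη]
      apply Sp.C_mul
      intro k hk
      rw [coeff_X'] at hk
      have : k = Finsupp.single 0 1 := by
        by_contra h; simp [Ne.symm h] at hk
      subst this
      simp [wt]
    | insert n J hn ih =>
      obtain ⟨Q, Qb, hQ, hco, hsp⟩ := ih
      refine ⟨En (n 1) Q, En (n 1) Qb, hQ.En _, ?_, ?_⟩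
      · intro k
        rw [coeff_En, hco, Finset.prod_insert hn]; ring
      · unfold En
        rw [map_sub, map_mul, map_mul, h]
        have hjac : Jac (σ (X 0)) (σ Q) = C c * σ (pderiv 1 Q) := by
          rw [Jac_comp σ τ h, hJ]
          have : Jac (X 0) Q = pderiv 1 Q := by simp [Jac, pderiv_X]
          rw [this]; ring
        have e : σ (pderiv 1 Q) = C c⁻¹ * Jac (σ (X 0)) (σ Q) := by
          rw [hjac, ← mul_assoc, ← C_mul, inv_mul_cancel₀ hc]; simp
        rw [e]
        rw [Finset.card_insert_of_notMem hn]
        have pos : 0 < (l - 1) * (w0 + w1) := mul_pos (by linarith) (by linarith)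
        refine Sp.sub ((h1.le.mul_le ((h0.le.jac hsp).C_mul _)).mono ?_) ((hsp.C_mul _).mono ?_)
        · intro x hx
          simp at *
          linarith
        · intro x hx
          simp at *
          linarith
  obtain ⟨Q, Qb, hQ, hco, hsp⟩ := step ((σb (X 0)).support.erase m)
  have hdist : ∀ n ∈ (σb (X 0)).support, n ≠ m → n 1 ≠ m 1 := by
    intro n hn hne h1
    apply hne
    have e1 : wt w0 w1 n = l * w0 := h0.1 n (mem_support_iff.mp hn)
    have e2 : wt w0 w1 m = l * w0 := h0.1 m hm
    unfold wt at e1 e2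
    rw [h1] at e1
    have : (n 0 : ℝ) * w0 = m 0 * w0 := by linarith
    have : (n 0 : ℝ) = m 0 := mul_right_cancel₀ hw0.ne' this
    ext i
    fin_cases i
    · exact_mod_cast this
    · exact h1
  have hQb : Qb = monomial m (coeff m Qb) := by
    ext k
    rw [coeff_monomial]
    split_ifs with hk
    · rw [hk]
    · rw [hco]
      by_cases hs : k ∈ (σb (X 0)).support
      · rw [Finset.prod_eq_zero (i := k) (by simp [Ne.symm hk, mem_support_iff.mp hs]) (by simp), zero_mul]
      · rw [notMem_support_iff.mp hs, mul_zero]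
  have hcm : coeff m Qb ≠ 0 := by
    rw [hco]
    refine mul_ne_zero (Finset.prod_ne_zero_iff.mpr ?_) hm
    intro n hn
    rw [Finset.mem_erase] at hn
    have := hdist n hn.2 hn.1
    rw [sub_ne_zero]
    exact_mod_cast this.symm
  have hld := Ld.subst (by linarith) σ σb τ h hb h0 h1 hQ
  have hne : σb Qb ≠ 0 := by
    rw [hQb, monomial_R2]
    simp only [map_mul, map_pow, hb]
    refine mul_ne_zero ?_ (mul_ne_zero (pow_ne_zero _ hU) (pow_ne_zero _ hV))
    rw [Ne, C_eq_zero]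
    exact hτ _ hcm
  have hbd := hld.bound hne hsp
  rw [Finset.card_erase_of_mem (mem_support_iff.mpr hm)] at hbd
  have hcard : 1 ≤ (σb (X 0)).support.card := Finset.card_pos.mpr ⟨m, mem_support_iff.mpr hm⟩
  push_cast [Nat.cast_sub hcard] at hbd
  have : (l - 1) * (w0 * (l + 1)) ≤ (l - 1) * ((((σb (X 0)).support.card : ℝ) - 1) * (w0 + w1)) := by
    linarith
  exact le_of_mul_le_mul_left this (by linarith)

end RF

namespace RF

def Nm (d : ℕ) (φ : R2 →+* R2) : Prop :=
  (∀ ξ : ℂ, ξ ^ d = 1 → ∀ r, φ (De ξ r) = De ξ (φ r)) ∨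
  (∀ ξ : ℂ, ξ ^ d = 1 → ∀ r, φ (De ξ r) = De ξ⁻¹ (φ r))

lemma inv_root {d : ℕ} {ξ : ℂ} (h : ξ ^ d = 1) : ξ⁻¹ ^ d = 1 := by rw [inv_pow, h, inv_one]

lemma Nm.comp {d : ℕ} {f g : R2 →+* R2} (hf : Nm d f) (hg : Nm d g) : Nm d (f.comp g) := by
  rcases hf with hf | hf <;> rcases hg with hg | hg
  · left; intro ξ h r; simp [hg ξ h, hf ξ h]
  · right; intro ξ h r; simp only [RingHom.comp_apply, hg ξ h, hf _ (inv_root h)]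
  · right; intro ξ h r; simp only [RingHom.comp_apply, hg ξ h, hf ξ h]
  · left; intro ξ h r; simp only [RingHom.comp_apply, hg ξ h, hf _ (inv_root h), inv_inv]

abbrev Nme (d : ℕ) (ψ : R2 ≃ₐ[ℂ] R2) : Prop := Nm d (ψ : R2 →+* R2)

lemma Nme.symm {d : ℕ} {ψ : R2 ≃ₐ[ℂ] R2} (h : Nme d ψ) : Nme d ψ.symm := by
  rcases h with h | h
  · left; intro ξ hx r
    apply ψ.injective
    have := h ξ hx (ψ.symm r)
    simp at this ⊢
    rw [this]
  · right; intro ξ hx r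
    apply ψ.injective
    have := h _ (inv_root hx) (ψ.symm r)
    simp at this ⊢
    rw [this]

noncomputable def cj (ψ : R2 ≃ₐ[ℂ] R2) (σ : R2 →+* R2) : R2 →+* R2 :=
  (ψ.symm : R2 →+* R2).comp (σ.comp (ψ : R2 →+* R2))

lemma cj_apply (ψ : R2 ≃ₐ[ℂ] R2) (σ : R2 →+* R2) (r : R2) : cj ψ σ r = ψ.symm (σ (ψ r)) := rfl

structure Adm (d : ℕ) (σ : R2 →+* R2) : Prop where
  c : ∀ a, σ (C a) = C (starRingEnd ℂ a)
  nm : Nm d σ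
  sq : ∃ ξ : ℂ, ξ ^ d = 1 ∧ ∀ r, σ (σ r) = De ξ r

lemma ae_C (ψ : R2 ≃ₐ[ℂ] R2) (a : ℂ) : ψ (C a) = C a := by
  rw [← algebraMap_eq]; exact ψ.commutes a

lemma Adm.cj {d : ℕ} {σ : R2 →+* R2} (h : Adm d σ) {ψ : R2 ≃ₐ[ℂ] R2} (hψ : Nme d ψ) : Adm d (cj ψ σ) := by
  refine ⟨?_, hψ.symm.comp (h.nm.comp hψ), ?_⟩
  · intro a; rw [cj_apply, ae_C, h.c, ae_C]
  · obtain ⟨ξ, hx, h2⟩ := h.sq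
    rcases hψ with h3 | h3
    · refine ⟨ξ, hx, fun r => ?_⟩
      have := h3 ξ hx r
      simp at this
      simp [cj_apply, h2, ← this]
    · refine ⟨ξ⁻¹, inv_root hx, fun r => ?_⟩
      have := h3 _ (inv_root hx) r
      rw [inv_inv] at this
      simp at this
      simp [cj_apply, h2, ← this]

lemma conj_root {d : ℕ} (hd : 0 < d) {ξ : ℂ} (h : ξ ^ d = 1) : starRingEnd ℂ ξ = ξ⁻¹ := by
  rw [Complex.inv_def, Complex.normSq_eq_norm_sq, Complex.norm_eq_one_of_pow_eq_one h hd.ne']; simp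

lemma Adm.cls {d : ℕ} (hd : 0 < d) {σ : R2 →+* R2} (h : Adm d σ) : Cls d (σ (X 0)) (σ (X 1)) := by
  rcases h.nm with h3 | h3
  · right; intro ξ hx
    have h0 := h3 ξ hx (X 0)
    have h1 := h3 ξ hx (X 1)
    simp only [dg_0, dg_1, map_mul, h.c, map_inv₀, conj_root hd hx, inv_inv] at h0 h1
    exact ⟨h0.symm, h1.symm⟩
  · left; intro ξ hx
    have h0 := h3 _ (inv_root hx) (X 0)
    have h1 := h3 _ (inv_root hx) (X 1)
    simp only [dg_0, dg_1, map_mul, h.c, map_inv₀, conj_root hd hx, inv_inv] at h0 h1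
    exact ⟨h0.symm, h1.symm⟩

lemma Adm.jac {d : ℕ} (hd : 0 < d) {σ : R2 →+* R2} (h : Adm d σ) : ∃ c : ℂ, c ≠ 0 ∧ Jac (σ (X 0)) (σ (X 1)) = C c := by
  obtain ⟨ξ, hx, h2⟩ := h.sq
  have h0 : ξ ≠ 0 := by rintro rfl; simp [hd.ne'] at hx
  exact Jac_unit σ _ h.c (σ (X 0)) (σ (X 1)) ξ ξ⁻¹ h0 (inv_ne_zero h0) (by rw [h2]; simp) (by rw [h2]; simp)

/-- triangular automorphisms -/
noncomputable def tri (p q : ℂ) (hp : p ≠ 0) (hq : q ≠ 0) (g : Polynomial ℂ) : R2 ≃ₐ[ℂ] R2 :=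
  AlgEquiv.ofAlgHom (aeval ![C p * X 0, C q * X 1 + Polynomial.aeval (X 0) g])
    (aeval ![C p⁻¹ * X 0, C q⁻¹ * (X 1 - Polynomial.aeval (C p⁻¹ * X 0) g)])
    (by
      apply MvPolynomial.algHom_ext
      intro i
      have e1 : (C p * C p⁻¹ : R2) = 1 := by rw [← C_mul, mul_inv_cancel₀ hp, C_1]
      have e2 : (C q⁻¹ * C q : R2) = 1 := by rw [← C_mul, inv_mul_cancel₀ hq, C_1]
      fin_cases i
      · simp [← mul_assoc, ← algebraMap_eq]
        simp [algebraMap_eq, ← C_mul, hp]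
      · have : (Polynomial.aeval (C p⁻¹ * X 0 : R2) g) = aeval (R := ℂ) ![(C p⁻¹ * X 0 : R2), 0] (Polynomial.aeval (X 0 : R2) g) := by
          rw [← Polynomial.aeval_algHom_apply]; simp
        simp only [AlgHom.comp_apply, Fin.mk_one, aeval_X, Matrix.cons_val_one, AlgHom.id_apply, map_mul, map_sub,
          ← Polynomial.aeval_algHom_apply, Matrix.cons_val_zero, Matrix.cons_val_fin_one, AlgHom.id_apply]
        rw [← algebraMap_eq, AlgHom.commutes, AlgHom.commutes, algebraMap_eq, ← mul_assoc (C p⁻¹), mul_comm (C p⁻¹), e1, one_mul, add_sub_cancel_right,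
          ← mul_assoc, e2, one_mul])
    (by
      apply MvPolynomial.algHom_ext
      intro i
      have e1 : (C p * C p⁻¹ : R2) = 1 := by rw [← C_mul, mul_inv_cancel₀ hp, C_1]
      have e2 : (C q * C q⁻¹ : R2) = 1 := by rw [← C_mul, mul_inv_cancel₀ hq, C_1]
      fin_cases i
      · simp [← mul_assoc, ← algebraMap_eq]
        simp [algebraMap_eq, ← C_mul, hp]
      · simp only [AlgHom.comp_apply, Fin.mk_one, aeval_X, Matrix.cons_val_one, AlgHom.id_apply, map_mul, map_sub, map_add,
          ← Polynomial.aeval_algHom_apply, Matrix.cons_val_zero, Matrix.cons_val_fin_one, AlgHom.id_apply]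
        rw [← algebraMap_eq, AlgHom.commutes, algebraMap_eq, ← mul_assoc, e2, one_mul, sub_add_cancel])

section
variable (p q : ℂ) (hp : p ≠ 0) (hq : q ≠ 0) (g : Polynomial ℂ)
@[simp] lemma tri_0 : tri p q hp hq g (X 0) = C p * X 0 := by simp [tri]
@[simp] lemma tri_1 : tri p q hp hq g (X 1) = C q * X 1 + Polynomial.aeval (X 0) g := by simp [tri]
@[simp] lemma tri_s0 : (tri p q hp hq g).symm (X 0) = C p⁻¹ * X 0 := by simp [tri]
@[simp] lemma tri_s1 : (tri p q hp hq g).symm (X 1) = C q⁻¹ * (X 1 - Polynomial.aeval (C p⁻¹ * X 0) g) := by simp [tri]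
end

lemma Nme_of {d : ℕ} (ψ : R2 ≃ₐ[ℂ] R2) (h0 : ∀ ξ, ξ ^ d = 1 → De ξ (ψ (X 0)) = C ξ * ψ (X 0))
    (h1 : ∀ ξ, ξ ^ d = 1 → De ξ (ψ (X 1)) = C ξ⁻¹ * ψ (X 1)) : Nme d ψ := by
  left
  intro ξ hx r
  have : (ψ : R2 →ₐ[ℂ] R2).comp (De ξ) = (De ξ).comp (ψ : R2 →ₐ[ℂ] R2) := by
    apply MvPolynomial.algHom_ext
    intro i
    fin_cases i
    · simp [h0 ξ hx, ae_C]
    · simp [h1 ξ hx, ae_C]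
  exact DFunLike.congr_fun this r

noncomputable def sw : R2 ≃ₐ[ℂ] R2 := renameEquiv ℂ (Equiv.swap 0 1)
@[simp] lemma sw_0 : sw (X 0) = X 1 := by simp [sw]
@[simp] lemma sw_1 : sw (X 1) = X 0 := by simp [sw]
@[simp] lemma sw_symm : sw.symm = sw := by ext i; simp [sw]
lemma Nme_sw (d : ℕ) : Nme d sw := by
  right
  intro ξ hx r
  have : (sw : R2 →ₐ[ℂ] R2).comp (De ξ) = (De ξ⁻¹).comp (sw : R2 →ₐ[ℂ] R2) := by
    apply MvPolynomial.algHom_ext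
    intro i
    fin_cases i
    · simp [ae_C]
    · simp [ae_C]
  exact DFunLike.congr_fun this r

noncomputable def sm (m : Fin 2 →₀ ℕ) : Fin 2 →₀ ℕ := Finsupp.single 0 (m 1) + Finsupp.single 1 (m 0)
@[simp] lemma sm_0 (m) : sm m 0 = m 1 := by simp [sm]
@[simp] lemma sm_1 (m) : sm m 1 = m 0 := by simp [sm]
@[simp] lemma sm_sm (m) : sm (sm m) = m := by ext i; fin_cases i <;> simp
lemma wt_sm (w0 w1 : ℝ) (m) : wt w0 w1 (sm m) = wt w1 w0 m := by simp [wt]; ring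
lemma coeff_sw (f : R2) (m) : coeff m (sw f) = coeff (sm m) f := by
  induction f using MvPolynomial.induction_on' with
  | add p q hp hq => simp only [map_add, coeff_add, hp, hq]
  | monomial n c =>
    have h : sw (monomial n c) = monomial (sm n) c := by
      rw [monomial_R2, monomial_R2]
      simp only [map_mul, map_pow, sw_0, sw_1, ae_C, sm_0, sm_1]
      ring
    rw [h, coeff_monomial, coeff_monomial]
    have : sm n = m ↔ n = sm m := ⟨fun h => by rw [← h, sm_sm], fun h => by rw [h, sm_sm]⟩
    simp only [this]

def Term (d : ℕ) (σ : R2 →+* R2) : Prop :=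
  (σ (X 0) = X 0 ∧ σ (X 1) = X 1) ∨ ∃ s : ℂ, s ≠ 0 ∧ (s ^ d = 1 ∨ s ^ d = -1 ∧ Even d) ∧ σ (X 0) = C s⁻¹ * X 1 ∧ σ (X 1) = C s * X 0

def Red (d : ℕ) (σ : R2 →+* R2) : Prop := ∃ ψ : R2 ≃ₐ[ℂ] R2, Nme d ψ ∧ Term d (cj ψ σ)

lemma Red.of_cj {d : ℕ} {σ : R2 →+* R2} {ψ : R2 ≃ₐ[ℂ] R2} (hψ : Nme d ψ) (h : Red d (cj ψ σ)) : Red d σ := by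
  obtain ⟨χ, h1, h2⟩ := h
  refine ⟨χ.trans ψ, hψ.comp h1, ?_⟩
  exact h2

end RF

namespace RF

def Eig (U V : R2) (w0 w1 l : ℝ) : Prop :=
  0 < w0 ∧ 0 < w1 ∧ Sp w0 w1 (Set.Iic (l * w0)) U ∧ (∃ m, coeff m U ≠ 0 ∧ wt w0 w1 m = l * w0) ∧
    Sp w0 w1 (Set.Iic (l * w1)) V ∧ (∃ m, coeff m V ≠ 0 ∧ wt w0 w1 m = l * w1)

lemma wt_smul (k w0 w1 : ℝ) (m) : wt (k * w0) (k * w1) m = k * wt w0 w1 m := by simp [wt]; ring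

lemma Eig.smul {U V : R2} {w0 w1 l : ℝ} (h : Eig U V w0 w1 l) {k : ℝ} (hk : 0 < k) : Eig U V (k * w0) (k * w1) l := by
  obtain ⟨h0, h1, h2, ⟨m, hm, hm'⟩, h3, ⟨n, hn, hn'⟩⟩ := h
  refine ⟨by positivity, by positivity, ?_, ⟨m, hm, by rw [wt_smul, hm']; ring⟩, ?_, ⟨n, hn, by rw [wt_smul, hn']; ring⟩⟩
  · intro a ha
    have := h2 a ha
    simp only [Set.mem_Iic, wt_smul] at *
    nlinarith
  · intro a ha
    have := h3 a ha
    simp only [Set.mem_Iic, wt_smul] at *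
    nlinarith

lemma Eig.sw {U V : R2} {w0 w1 l : ℝ} (h : Eig U V w0 w1 l) : Eig (sw V) (sw U) w1 w0 l := by
  obtain ⟨h0, h1, h2, ⟨m, hm, hm'⟩, h3, ⟨n, hn, hn'⟩⟩ := h
  refine ⟨h1, h0, ?_, ⟨sm n, by rwa [coeff_sw, sm_sm], by rwa [wt_sm]⟩, ?_, ⟨sm m, by rwa [coeff_sw, sm_sm], by rwa [wt_sm]⟩⟩
  · intro a ha
    rw [coeff_sw] at ha
    have := h3 _ ha
    rwa [wt_sm] at this
  · intro a ha
    rw [coeff_sw] at ha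
    have := h2 _ ha
    rwa [wt_sm] at this

lemma bdd_supp (U : R2) : ∃ N : ℝ, 0 ≤ N ∧ ∀ m, coeff m U ≠ 0 → (m 0 : ℝ) ≤ N ∧ (m 1 : ℝ) ≤ N := by
  refine ⟨∑ m ∈ U.support, ((m 0 : ℝ) + m 1), by positivity, fun m hm => ?_⟩
  have := Finset.single_le_sum (f := fun m : Fin 2 →₀ ℕ => ((m 0 : ℝ) + m 1)) (s := U.support) (fun i _ => by positivity)
    (mem_support_iff.mpr hm)
  have h0 : (0:ℝ) ≤ m 0 := by positivity
  have h1 : (0:ℝ) ≤ m 1 := by positivity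
  constructor <;> linarith

lemma Eig.bdd (U V : R2) : ∃ n : ℕ, ∀ w0 w1 l, Eig U V w0 w1 l → l < n + 1 := by
  obtain ⟨N, hN, hU⟩ := bdd_supp U
  obtain ⟨M, hM, hV⟩ := bdd_supp V
  obtain ⟨n, hn⟩ := exists_nat_ge (N + M)
  refine ⟨n, ?_⟩
  rintro w0 w1 l ⟨h0, h1, h2, ⟨m, hm, hm'⟩, h3, ⟨k, hk, hk'⟩⟩
  obtain ⟨a1, a2⟩ := hU m hm
  obtain ⟨a3, a4⟩ := hV k hk
  by_contra hl
  push Not at hl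
  unfold wt at hm' hk'
  nlinarith [mul_le_mul_of_nonneg_right a1 h0.le, mul_le_mul_of_nonneg_right a2 h1.le,
   mul_le_mul_of_nonneg_right a3 h0.le, mul_le_mul_of_nonneg_right a4 h1.le, mul_pos (show 0 < l - (N + M) by linarith) (show 0 < w0 + w1 by linarith)]

lemma Eig.ex (U V : R2) (m n : Fin 2 →₀ ℕ) (hm : coeff m U ≠ 0) (hm1 : 1 ≤ m 1) (hn : coeff n V ≠ 0) (hn0 : 1 ≤ n 0) :
    ∃ w0 w1 l, Eig U V w0 w1 l := by
  obtain ⟨N, hN, hU⟩ := bdd_supp U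
  obtain ⟨M, hM, hV⟩ := bdd_supp V
  have eU : U.support.Nonempty := ⟨m, mem_support_iff.mpr hm⟩
  have eV : V.support.Nonempty := ⟨n, mem_support_iff.mpr hn⟩
  let T1 : ℝ → ℝ := fun s => U.support.sup' eU (fun a => wt 1 s a)
  let T2 : ℝ → ℝ := fun s => V.support.sup' eV (fun a => wt 1 s a)
  have c1 : Continuous T1 := Continuous.finset_sup'_apply eU (fun i _ => by unfold wt; fun_prop)
  have c2 : Continuous T2 := Continuous.finset_sup'_apply eV (fun i _ => by unfold wt; fun_prop)
  have u1 : ∀ s, 0 ≤ s → T1 s ≤ N * (1 + s) := by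
    intro s hs
    apply Finset.sup'_le
    intro a ha
    obtain ⟨h1, h2⟩ := hU a (mem_support_iff.mp ha)
    unfold wt; nlinarith
  have u2 : ∀ s, 0 ≤ s → T2 s ≤ M * (1 + s) := by
    intro s hs
    apply Finset.sup'_le
    intro a ha
    obtain ⟨h1, h2⟩ := hV a (mem_support_iff.mp ha)
    unfold wt; nlinarith
  have l1 : ∀ s, 0 ≤ s → s ≤ T1 s := by
    intro s hs
    refine le_trans ?_ (Finset.le_sup' _ (mem_support_iff.mpr hm))
    have h1 : (1:ℝ) ≤ m 1 := by exact_mod_cast hm1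
    have h0 : (0:ℝ) ≤ m 0 := by positivity
    unfold wt; nlinarith
  have l2 : ∀ s, 0 ≤ s → 1 ≤ T2 s := by
    intro s hs
    refine le_trans ?_ (Finset.le_sup' _ (mem_support_iff.mpr hn))
    have h1 : (1:ℝ) ≤ n 0 := by exact_mod_cast hn0
    have h0 : (0:ℝ) ≤ n 1 := by positivity
    unfold wt; nlinarith
  let φ : ℝ → ℝ := fun s => s * T1 s - T2 s
  have cφ : Continuous φ := by fun_prop
  set s0 : ℝ := 1 / (2 * N + 2) with hs0
  have s0p : 0 < s0 := by positivity
  have s0e : s0 * (2 * N + 2) = 1 := by rw [hs0]; field_simp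
  have s01 : s0 ≤ 1 := by nlinarith
  have b0 : φ s0 ≤ 0 := by
    have := u1 s0 s0p.le
    have := l2 s0 s0p.le
    have h3 : s0 * T1 s0 ≤ s0 * (N * (1 + s0)) := by gcongr
    have h4 : s0 * (N * (1 + s0)) ≤ s0 * (N * 2) := by gcongr; linarith
    simp only [φ]
    nlinarith
  have b1 : 0 ≤ φ (M + 1) := by
    have := u2 (M+1) (by linarith)
    have := l1 (M+1) (by linarith)
    have h3 : (M+1) * (M+1) ≤ (M+1) * T1 (M+1) := by gcongr
    simp only [φ]
    nlinarith
  obtain ⟨s, hs, hs'⟩ := intermediate_value_Icc (show s0 ≤ M + 1 by linarith) cφ.continuousOn (show (0:ℝ) ∈ Set.Icc (φ s0) (φ (M+1)) from ⟨b0, b1⟩)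
  have sp : 0 < s := lt_of_lt_of_le s0p hs.1
  have hT : T2 s = T1 s * s := by simp only [φ] at hs'; linarith
  obtain ⟨a, ha, ha'⟩ := Finset.exists_mem_eq_sup' eU (fun a => wt 1 s a)
  obtain ⟨b, hb, hb'⟩ := Finset.exists_mem_eq_sup' eV (fun a => wt 1 s a)
  refine ⟨1, s, T1 s, one_pos, sp, ?_, ⟨a, mem_support_iff.mp ha, ?_⟩, ?_, ⟨b, mem_support_iff.mp hb, ?_⟩⟩
  · intro k hk
    rw [mul_one]
    exact Finset.le_sup' (fun a => wt 1 s a) (mem_support_iff.mpr hk)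
  · rw [mul_one]; exact ha'.symm
  · intro k hk
    rw [← hT]
    exact Finset.le_sup' (fun a => wt 1 s a) (mem_support_iff.mpr hk)
  · rw [← hT]; exact hb'.symm

end RF

namespace RF

lemma root_ex {d : ℕ} (hd : 3 ≤ d) : ∃ ω : ℂ, ω ^ d = 1 ∧ ω ≠ 1 ∧ ω ^ 2 ≠ 1 ∧ ω ≠ 0 := by
  have hz := Complex.isPrimitiveRoot_exp d (by omega)
  refine ⟨_, hz.pow_eq_one, hz.ne_one (by omega), ?_, Complex.exp_ne_zero _⟩
  intro h
  have := Nat.le_of_dvd (by norm_num) (hz.dvd_of_pow_eq_one 2 h)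
  omega

lemma coeff_eig {ξ c : ℂ} {U : R2} (h : De ξ U = C c * U) {m} (hm : coeff m U ≠ 0) : ξ ^ m 0 * ξ⁻¹ ^ m 1 = c := by
  have := congrArg (coeff m) h
  rw [coeff_dg, coeff_C_mul] at this
  exact mul_right_cancel₀ hm this

lemma mono_ext {U : R2} (k : Fin 2 →₀ ℕ) (h : ∀ m, coeff m U ≠ 0 → m = k) : U = monomial k (coeff k U) := by
  ext m
  rw [coeff_monomial]
  split_ifs with h1
  · rw [h1]
  · by_contra h2; exact h1 (h m h2).symm

lemma fin2_ext {m n : Fin 2 →₀ ℕ} (h0 : m 0 = n 0) (h1 : m 1 = n 1) : m = n := by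
  ext i; fin_cases i <;> assumption

lemma mono_ext0 {U : R2} (h : ∀ m, coeff m U ≠ 0 → m 0 = 1 ∧ m 1 = 0) : ∃ a, U = C a * X 0 := by
  refine ⟨coeff (Finsupp.single 0 1) U, (mono_ext (Finsupp.single 0 1) fun m hm => ?_).trans ?_⟩
  · obtain ⟨h0, h1⟩ := h m hm
    exact fin2_ext (by simpa using h0) (by simpa using h1)
  · rw [monomial_R2]; simp

lemma mono_ext1 {U : R2} (h : ∀ m, coeff m U ≠ 0 → m 0 = 0 ∧ m 1 = 1) : ∃ a, U = C a * X 1 := by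
  refine ⟨coeff (Finsupp.single 1 1) U, (mono_ext (Finsupp.single 1 1) fun m hm => ?_).trans ?_⟩
  · obtain ⟨h0, h1⟩ := h m hm
    exact fin2_ext (by simpa using h0) (by simpa using h1)
  · rw [monomial_R2]; simp

lemma term_lin {d : ℕ} (hd : 3 ≤ d) {U V : R2} (hc : Cls d U V) {w0 w1 l : ℝ} (h : Eig U V w0 w1 l) (hl : l ≤ 1)
    (m n : Fin 2 →₀ ℕ) (hm : coeff m U ≠ 0) (hm1 : 1 ≤ m 1) (hn : coeff n V ≠ 0) (hn0 : 1 ≤ n 0) :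
    (∃ a, U = C a * X 1) ∧ ∃ b, V = C b * X 0 := by
  obtain ⟨h0, h1, h2, -, h3, -⟩ := h
  have em := h2 m hm
  have en := h3 n hn
  simp only [Set.mem_Iic, wt] at em en
  have m1' : (1:ℝ) ≤ m 1 := by exact_mod_cast hm1
  have n0' : (1:ℝ) ≤ n 0 := by exact_mod_cast hn0
  have m0' : (0:ℝ) ≤ m 0 := by positivity
  have n1' : (0:ℝ) ≤ n 1 := by positivity
  have p1 : w1 ≤ l * w0 := by nlinarith
  have p2 : w0 ≤ l * w1 := by nlinarith
  have ew : w0 = w1 := by nlinarith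
  subst ew
  have el : l = 1 := by nlinarith
  subst el
  have key : ∀ f : R2, Sp w0 w0 (Set.Iic (1 * w0)) f → ∀ a, coeff a f ≠ 0 → a 0 + a 1 ≤ 1 := by
    intro f hf a ha
    have := hf a ha
    simp only [Set.mem_Iic, wt] at this
    have : ((a 0 : ℝ) + a 1) ≤ 1 := by
      by_contra hh; push Not at hh; nlinarith
    exact_mod_cast this
  obtain ⟨ω, r1, r2, r3, r4⟩ := root_ex hd
  have km := key U h2 m hm
  have m1 : m 1 = 1 := by omega
  have m0 : m 0 = 0 := by omega
  rcases hc with hc | hc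
  · exfalso
    have := coeff_eig (hc ω r1).1 hm
    rw [m1, m0] at this
    simp at this
    apply r3
    rw [pow_two]; nth_rw 1 [← this]; exact inv_mul_cancel₀ r4
  · constructor
    · apply mono_ext1
      intro a ha
      have := coeff_eig (hc ω r1).1 ha
      have ka := key U h2 a ha
      have : a 1 = 1 := by
        by_contra hh
        have a1 : a 1 = 0 := by omega
        rw [a1] at this
        have : a 0 = 0 ∨ a 0 = 1 := by omega
        rcases this with h | h
        · simp [h] at this; exact r2 this
        · simp [h] at this
          apply r3
          rw [pow_two]; nth_rw 1 [this]; exact inv_mul_cancel₀ r4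
      omega
    · apply mono_ext0
      intro a ha
      have := coeff_eig (hc ω r1).2 ha
      have ka := key V h3 a ha
      have : a 0 = 1 := by
        by_contra hh
        have a0 : a 0 = 0 := by omega
        rw [a0] at this
        have : a 1 = 0 ∨ a 1 = 1 := by omega
        rcases this with h | h
        · simp [h] at this; exact r2 this.symm
        · simp [h] at this
          apply r3
          rw [pow_two]; nth_rw 1 [← this]; exact inv_mul_cancel₀ r4
      omega

lemma CX_inj {a b : ℂ} {i : Fin 2} (h : (C a * X i : R2) = C b * X i) : a = b :=
  C_injective _ _ (mul_right_cancel₀ (X_ne_zero i) h)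

lemma Nme_diag (d : ℕ) (p q : ℂ) (hp hq) : Nme d (tri p q hp hq 0) := by
  apply Nme_of
  · intro ξ _; simp only [tri_0, map_mul, dg_C, dg_0]; ring
  · intro ξ _; simp only [tri_1, map_mul, dg_C, dg_1, map_zero, add_zero]; ring

lemma red_anti {d : ℕ} (hd : 3 ≤ d) {σ : R2 →+* R2} (h : Adm d σ) {a b : ℂ} (h0 : σ (X 0) = C a * X 1)
    (h1 : σ (X 1) = C b * X 0) : Red d σ := by
  obtain ⟨ξ, hx, hs⟩ := h.sq
  have e := hs (X 0)
  rw [h0, map_mul, h.c, h1, dg_0, ← mul_assoc, ← C_mul] at e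
  have e := CX_inj e
  have hx0 : ξ ≠ 0 := by rintro rfl; simp [show d ≠ 0 by omega] at hx
  have ha : a ≠ 0 := by rintro rfl; simp at e; exact hx0 e.symm
  obtain ⟨s, s2, sd⟩ : ∃ s : ℂ, s ^ 2 = ξ ∧ (s ^ d = 1 ∨ s ^ d = -1 ∧ Even d) := by
    obtain ⟨s, hs⟩ := IsAlgClosed.exists_pow_nat_eq ξ (n := 2) (by norm_num)
    have : (s ^ d) ^ 2 = 1 := by rw [← pow_mul, mul_comm, pow_mul, hs, hx]
    rcases (sq_eq_sq_iff_eq_or_eq_neg.mp (this.trans (one_pow 2).symm)) with h | h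
    · exact ⟨s, hs, Or.inl h⟩
    · rcases Nat.even_or_odd d with hd | hd
      · exact ⟨s, hs, Or.inr ⟨h, hd⟩⟩
      · exact ⟨-s, by rw [neg_sq, hs], Or.inl (by rw [hd.neg_pow, h, neg_neg])⟩
  have s0 : s ≠ 0 := by rintro rfl; simp at s2; exact hx0 s2.symm
  have cs : starRingEnd ℂ s = s⁻¹ := conj_root (d := 2 * d) (by omega) (by rw [pow_mul, s2, hx])
  refine ⟨tri 1 (a * s) one_ne_zero (mul_ne_zero ha s0) 0, Nme_diag _ _ _ _ _, Or.inr ⟨s, s0, sd, ?_, ?_⟩⟩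
  · simp only [cj_apply, tri_0, map_mul, map_one, h0, tri_s1, ae_C, map_zero, sub_zero]
    rw [one_mul, ← mul_assoc, ← C_mul]
    congr 2
    field_simp
  · simp only [cj_apply, tri_1, map_mul, h.c, map_one, h1, tri_s0, ae_C, map_zero, add_zero, inv_one]
    rw [one_mul, ← C_mul, ← mul_assoc, ← C_mul, cs, mul_right_comm, e, ← s2]
    congr 2
    field_simp

lemma pd1_zero {W : R2} : pderiv 1 W = 0 ↔ ∀ m, coeff m W ≠ 0 → m 1 = 0 := by
  constructor
  · intro h m hm
    by_contra h1
    have e : m = (m - Finsupp.single 1 1) + Finsupp.single 1 1 := by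
      refine fin2_ext ?_ ?_
      · simp
      · simp; omega
    have h2 := congrArg (coeff (m - Finsupp.single 1 1)) h
    rw [coeff_pderiv, ← e, coeff_zero] at h2
    rcases mul_eq_zero.mp h2 with h3 | h3
    · exact hm h3
    · exact Nat.cast_add_one_ne_zero (R := ℂ) _ h3
  · intro h
    ext m
    rw [coeff_pderiv, coeff_zero]
    by_cases h2 : coeff (m + Finsupp.single 1 1) W = 0
    · rw [h2, zero_mul]
    · have := h _ h2; simp at this

lemma nox1 {W : R2} (h : ∀ m, coeff m W ≠ 0 → m 1 = 0) : ∃ g : Polynomial ℂ, W = Polynomial.aeval (X 0) g := by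
  refine ⟨∑ m ∈ W.support, Polynomial.monomial (m 0) (coeff m W), ?_⟩
  rw [map_sum]
  conv_lhs => rw [W.as_sum]
  apply Finset.sum_congr rfl
  intro m hm
  rw [monomial_R2, h m (mem_support_iff.mp hm), Polynomial.aeval_monomial, algebraMap_eq, pow_zero, mul_one]

lemma avg (a : ℂ) : ∃ α : ℂ, α + starRingEnd ℂ α * a ≠ 0 := by
  by_contra! h
  have h1 := h 1
  have h2 := h Complex.I
  simp at h1 h2
  have : a = -1 := by linear_combination h1
  rw [this] at h2
  simp at h2

lemma De_one (r : R2) : De 1 r = r := by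
  have : De 1 = AlgHom.id ℂ R2 := by
    apply MvPolynomial.algHom_ext
    intro i; fin_cases i <;> simp
  rw [this]; rfl

lemma red_bdry {d : ℕ} (hd : 3 ≤ d) {σ : R2 →+* R2} (h : Adm d σ) (hb : ∀ m, coeff m (σ (X 0)) ≠ 0 → m 1 = 0) : Red d σ := by
  obtain ⟨ω, r1, r2, r3, r4⟩ := root_ex hd
  obtain ⟨c, hc, hJ⟩ := h.jac (by omega)
  have hcl := h.cls (by omega)
  have hU1 := pd1_zero.mpr hb
  rw [Jac, hU1, zero_mul, sub_zero] at hJ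
  have hu : IsUnit (C c : R2) := (IsUnit.mk0 c hc).map C
  rw [← hJ] at hu
  obtain ⟨a, ha, hUa⟩ := isUnit_iff_eq_C_of_isReduced.mp (isUnit_of_mul_isUnit_left hu)
  obtain ⟨b, hb', hVb⟩ := isUnit_iff_eq_C_of_isReduced.mp (isUnit_of_mul_isUnit_right hu)
  obtain ⟨a', hU⟩ : ∃ a', σ (X 0) = C a' * X 0 := by
    apply mono_ext0
    intro m hm
    have m1 := hb m hm
    refine ⟨?_, m1⟩
    rcases Nat.eq_zero_or_pos (m 0) with m0 | m0
    · exfalso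
      rcases hcl with hcl | hcl
      · have := coeff_eig (hcl ω r1).1 hm
        simp [m0, m1] at this; exact r2 this.symm
      · have := coeff_eig (hcl ω r1).1 hm
        simp [m0, m1] at this; exact r2 this
    · have e : m = (m - Finsupp.single 0 1) + Finsupp.single 0 1 := by
        refine fin2_ext ?_ ?_
        · simp; omega
        · simp
      have h2 := congrArg (coeff (m - Finsupp.single 0 1)) hUa
      rw [coeff_pderiv, ← e, coeff_C] at h2
      have h3 : 0 = m - Finsupp.single 0 1 := by
        by_contra h3
        rw [if_neg h3] at h2
        rcases mul_eq_zero.mp h2 with h4 | h4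
        · exact hm h4
        · exact Nat.cast_add_one_ne_zero (R := ℂ) _ h4
      have := DFunLike.congr_fun h3 0
      simp at this; omega
  obtain ⟨g, hg⟩ : ∃ g : Polynomial ℂ, σ (X 1) - C b * X 1 = Polynomial.aeval (X 0) g := by
    apply nox1
    rw [← pd1_zero]
    simp [hVb]
  have hV : σ (X 1) = C b * X 1 + Polynomial.aeval (X 0) g := by rw [← hg]; ring
  obtain ⟨ξ, hx, hs⟩ := h.sq
  have e := hs (X 0)
  rw [hU, map_mul, h.c, hU, dg_0, ← mul_assoc, ← C_mul] at e
  have e := CX_inj e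
  have hx1 : ξ = 1 := by
    have n1 := Complex.norm_eq_one_of_pow_eq_one hx (by omega)
    rw [mul_comm, Complex.mul_conj] at e
    rw [← e, Complex.norm_real, Real.norm_of_nonneg (Complex.normSq_nonneg _)] at n1
    rw [← e, n1]; simp
  subst hx1
  have hs : ∀ r, σ (σ r) = r := fun r => by rw [hs, De_one]
  have a0 : a' ≠ 0 := by rintro rfl; simp at e
  have hcl : ∀ ξ : ℂ, ξ ^ d = 1 → De ξ (σ (X 1)) = C ξ⁻¹ * σ (X 1) := by
    rcases hcl with hcl | hcl
    · exact fun ξ hx => (hcl ξ hx).2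
    · exfalso
      have := (hcl ω r1).1
      rw [hU] at this
      simp only [map_mul, dg_C, dg_0] at this
      rw [← mul_assoc, ← mul_assoc, ← C_mul, ← C_mul] at this
      have := CX_inj this
      rw [mul_comm] at this
      have := mul_right_cancel₀ a0 this
      apply r3
      rw [pow_two]; nth_rw 1 [this]; exact inv_mul_cancel₀ r4
  obtain ⟨α, hα⟩ := avg a'
  obtain ⟨β, hβ⟩ := avg b
  let ψ := tri _ _ hα hβ (Polynomial.C (starRingEnd ℂ β) * g)
  have p0 : ψ (X 0) = C α * X 0 + σ (C α * X 0) := by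
    simp only [ψ, tri_0, map_mul, h.c, hU, map_add]; ring
  have p1 : ψ (X 1) = C β * X 1 + σ (C β * X 1) := by
    simp only [ψ, tri_1, map_mul, h.c, hV, map_add, Polynomial.aeval_C, algebraMap_eq]; ring
  refine ⟨ψ, Nme_of ψ ?_ ?_, Or.inl ⟨?_, ?_⟩⟩
  · intro ξ _; simp only [ψ, tri_0, map_mul, dg_C, dg_0]; ring
  · intro ξ hx; simp only [p1, map_mul, h.c, dg_C, dg_1, map_add, hcl ξ hx]; ring
  · rw [cj_apply, p0, map_add, hs, add_comm, ← p0, AlgEquiv.symm_apply_apply]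
  · rw [cj_apply, p1, map_add, hs, add_comm, ← p1, AlgEquiv.symm_apply_apply]

end RF

namespace RF

lemma leads {σ : R2 →+* R2} {w0 w1 l : ℝ} (h : Eig (σ (X 0)) (σ (X 1)) w0 w1 l) :
    ∃ σb : R2 →+* R2, (∀ c, σb (C c) = C (starRingEnd ℂ c)) ∧ Ld w0 w1 (l * w0) (σ (X 0)) (σb (X 0)) ∧
      Ld w0 w1 (l * w1) (σ (X 1)) (σb (X 1)) ∧ σb (X 0) ≠ 0 ∧ σb (X 1) ≠ 0 := by
  obtain ⟨h0, h1, h2, ⟨m, hm, hm'⟩, h3, ⟨n, hn, hn'⟩⟩ := h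
  obtain ⟨F, hF⟩ := Ld.ex h2
  obtain ⟨G, hG⟩ := Ld.ex h3
  refine ⟨eval₂Hom (C.comp (starRingEnd ℂ)) ![F, G], by simp, by simpa using hF, by simpa using hG, ?_, ?_⟩
  · simp only [coe_eval₂Hom, eval₂_X, Matrix.cons_val_zero]
    rintro rfl
    rw [← hF.coeff hm'] at hm; simp at hm
  · simp only [coe_eval₂Hom, eval₂_X, Matrix.cons_val_one, Matrix.cons_val_fin_one]
    rintro rfl
    rw [← hG.coeff hn'] at hn; simp at hn

lemma alg_root (P Q : R2) (hP : P ≠ 0) (l q : ℕ) (S : Finset (Fin 2 →₀ ℕ)) (hS : ∀ m ∈ S, m 0 + q * m 1 = l)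
    (hne : S.Nonempty) (a : (Fin 2 →₀ ℕ) → ℂ) (ha : ∀ m ∈ S, a m ≠ 0)
    (h : ∑ m ∈ S, C (a m) * (P ^ m 0 * Q ^ m 1) = 0) :
    ∃ c : ℂ, Q = C c * P ^ q ∧ ∑ m ∈ S, a m * c ^ m 1 = 0 := by
  let K := FractionRing R2
  let i := algebraMap R2 K
  have ii : Function.Injective i := IsFractionRing.injective R2 K
  have hP' : i P ≠ 0 := by rwa [Ne, map_eq_zero_iff i ii]
  have iC : ∀ z : ℂ, i (C z) = algebraMap ℂ K z := fun z => (IsScalarTower.algebraMap_apply ℂ R2 K z).symm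
  let t : K := i Q / i P ^ q
  have hQ : i Q = t * i P ^ q := by exact (div_mul_cancel₀ _ (pow_ne_zero _ hP')).symm
  let G : Polynomial ℂ := ∑ m ∈ S, Polynomial.monomial (m 1) (a m)
  have hG : G ≠ 0 := by
    obtain ⟨m, hm⟩ := hne
    intro h0
    have := congrArg (fun p => Polynomial.coeff p (m 1)) h0
    simp only [G, Polynomial.finsetSum_coeff, Polynomial.coeff_monomial, Polynomial.coeff_zero] at this
    rw [Finset.sum_eq_single m] at this
    · simp at this; exact ha m hm this
    · intro b hb hbm
      rw [if_neg]
      intro h1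
      apply hbm
      have e1 := hS b hb
      have e2 := hS m hm
      rw [h1] at e1
      exact fin2_ext (by omega) h1
    · intro h; exact absurd hm h
  have hGt : Polynomial.aeval t G = 0 := by
    have h1 := congrArg i h
    rw [map_sum, map_zero] at h1
    have h2 : i P ^ l * Polynomial.aeval t G = 0 := by
      rw [← h1]
      simp only [G, map_sum, Polynomial.aeval_monomial]
      rw [Finset.mul_sum]
      apply Finset.sum_congr rfl
      intro m hm
      rw [map_mul, map_mul, map_pow, map_pow, hQ, iC, ← hS m hm, pow_add, mul_pow, ← pow_mul]
      ring
    exact (mul_eq_zero.mp h2).resolve_left (pow_ne_zero _ hP')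
  have int : IsIntegral ℂ t := isAlgebraic_iff_isIntegral.mp ⟨G, hG, hGt⟩
  obtain ⟨c, hc⟩ := minpoly.mem_range_of_degree_eq_one ℂ t (IsAlgClosed.degree_eq_one_of_irreducible ℂ (minpoly.irreducible int))
  refine ⟨c, ?_, ?_⟩
  · apply ii
    rw [hQ, map_mul, map_pow, iC, hc]
  · rw [← hc, Polynomial.aeval_algebraMap_apply, map_eq_zero_iff _ (algebraMap ℂ K).injective] at hGt
    simpa [G, Polynomial.aeval_monomial] using hGt

lemma apply_sum (φ : R2 →+* R2) (τ : ℂ → ℂ) (h : ∀ c, φ (C c) = C (τ c)) (f : R2) :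
    φ f = ∑ m ∈ f.support, C (τ (coeff m f)) * (φ (X 0) ^ m 0 * φ (X 1) ^ m 1) := by
  conv_lhs => rw [f.as_sum, map_sum]
  apply Finset.sum_congr rfl
  intro m _
  rw [monomial_R2]
  simp only [map_mul, map_pow, h]

lemma Ld.De {w0 w1 a : ℝ} {f F : R2} (h : Ld w0 w1 a f F) {ξ c : ℂ} (hf : De ξ f = C c * f) : De ξ F = C c * F := by
  ext m
  rw [coeff_dg, coeff_C_mul]
  by_cases hm : MvPolynomial.coeff m F = 0
  · simp [hm]
  · have hw : wt w0 w1 m = a := h.1 m hm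
    have := congrArg (MvPolynomial.coeff m) hf
    rw [coeff_dg, coeff_C_mul] at this
    rw [h.coeff hw, this]

lemma step_c {d : ℕ} {σ : R2 →+* R2} (h : Adm d σ) {q : ℕ} {l : ℝ}
    (hl : 1 < l) (he : Eig (σ (X 0)) (σ (X 1)) 1 q l) :
    ∃ (L : ℕ) (c : ℂ) (F : R2), l = L ∧ F ≠ 0 ∧ c ≠ 0 ∧ Ld 1 q l (σ (X 0)) F ∧ Ld 1 q (l * q) (σ (X 1)) (C c * F ^ q) ∧
      ∑ m ∈ F.support, coeff m F * (starRingEnd ℂ c) ^ m 1 = 0 := by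
  obtain ⟨σb, hb, h0, h1, hU, hV⟩ := leads he
  obtain ⟨ξ, hx, hs⟩ := h.sq
  have hL : ∀ m, coeff m (σb (X 0)) ≠ 0 → ((m 0 + q * m 1 : ℕ) : ℝ) = l := by
    intro m hm
    have := h0.1 m hm
    simp [wt] at this
    push_cast; linarith
  obtain ⟨m, hm⟩ := ne_zero_iff.mp hU
  have hLm := hL m hm
  set L := m 0 + q * m 1
  have z : σb (σb (X 0)) = 0 := by
    by_contra hne
    have h3 := Ld.subst (by linarith) σ σb _ h.c hb h0 h1 h0
    rw [hs, dg_0] at h3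
    have := h3.bound hne (b := 1) (by
      apply Sp.C_mul
      intro k hk
      rw [coeff_X'] at hk
      split_ifs at hk with h4
      · subst h4; simp [wt]
      · simp at hk)
    nlinarith
  rw [apply_sum σb _ hb] at z
  obtain ⟨c, hc, hc'⟩ := alg_root _ _ hU L q (σb (X 0)).support (fun m hm => by
      have := hL m (mem_support_iff.mp hm)
      rw [← hLm] at this
      exact_mod_cast this) ⟨m, mem_support_iff.mpr hm⟩ (fun m => starRingEnd ℂ (coeff m (σb (X 0))))
      (fun m hm => by simpa using hm) z
  refine ⟨L, c, σb (X 0), hLm.symm, hU, ?_, by simpa using h0, hc ▸ h1, ?_⟩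
  · rintro rfl; simp at hc; exact hV hc
  · have := congrArg (starRingEnd ℂ) hc'
    simpa using this

lemma step {d : ℕ} (hd : 3 ≤ d) {σ : R2 →+* R2} (h : Adm d σ) {q : ℕ} (hq : 1 ≤ q) {l : ℝ}
    (hl : 1 < l) (he : Eig (σ (X 0)) (σ (X 1)) 1 q l) :
    (∃ L : ℕ, l = L) ∧ ∃ ψ, Nme d ψ ∧ ∀ w0 w1 l', Eig (cj ψ σ (X 0)) (cj ψ σ (X 1)) w0 w1 l' → l' < l := by
  obtain ⟨L, c, F, hL, hF, hc, hU, hV, hS⟩ := step_c h hl he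
  refine ⟨⟨L, hL⟩, ?_⟩
  have hξ : ∀ ξ : ℂ, ξ ^ d = 1 → ξ ^ q = ξ⁻¹ := by
    have aux : ∀ ξ η : ℂ, De ξ F = C η * F → De ξ (C c * F ^ q) = C η⁻¹ * (C c * F ^ q) → η ^ q = η⁻¹ := by
      intro ξ η e1 e2
      rw [map_mul, map_pow, dg_C, e1, mul_pow, ← mul_assoc, ← mul_assoc] at e2
      have e3 := mul_right_cancel₀ (pow_ne_zero q hF) e2
      rw [mul_comm] at e3
      have e4 := mul_right_cancel₀ (by rwa [Ne, C_eq_zero]) e3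
      rw [← C_pow] at e4
      exact C_injective _ _ e4
    intro ξ hx
    rcases h.cls (by omega) with hcl | hcl
    · exact aux ξ ξ (hU.De (hcl ξ hx).1) (hV.De (hcl ξ hx).2)
    · have := aux ξ ξ⁻¹ (hU.De (hcl ξ hx).1) (by rw [inv_inv]; exact (hV.De (hcl ξ hx).2))
      rw [inv_inv, inv_pow] at this
      exact inv_eq_iff_eq_inv.mp this
  let ψ := tri 1 1 one_ne_zero one_ne_zero (- (Polynomial.C (starRingEnd ℂ c) * Polynomial.X ^ q))
  have p0 : ψ (X 0) = X 0 := by simp [ψ]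
  have p1 : ψ (X 1) = X 1 - C (starRingEnd ℂ c) * X 0 ^ q := by
    simp [ψ, sub_eq_add_neg]
  have s0 : ψ.symm (X 0) = X 0 := by simp [ψ]
  have s1 : ψ.symm (X 1) = X 1 + C (starRingEnd ℂ c) * X 0 ^ q := by simp [ψ]
  refine ⟨ψ, Nme_of ψ ?_ ?_, ?_⟩
  · intro ξ hx; rw [p0, dg_0]
  · intro ξ hx; rw [p1]
    simp only [map_sub, map_mul, map_pow, dg_0, dg_1, dg_C, mul_pow, ← C_pow, hξ ξ hx]; ring
  have qpos : (0:ℝ) < q := by exact_mod_cast hq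
  have l0 : Ld 1 q (1 * 1) (X 0) (X 0) := by
    apply Ld.of_eq
    intro k hk
    rw [coeff_X'] at hk
    split_ifs at hk with h4
    · subst h4; simp [wt]
    · simp at hk
  have l1 : Ld 1 q (1 * q) (X 1) (X 1) := by
    apply Ld.of_eq
    intro k hk
    rw [coeff_X'] at hk
    split_ifs at hk with h4
    · subst h4; simp [wt]
    · simp at hk
  have t0 : Ld 1 q (1 * 1) (ψ.symm (X 0)) (ψ.symm (X 0)) := by rw [s0]; exact l0
  have t1 : Ld 1 q (1 * q) (ψ.symm (X 1)) (ψ.symm (X 1)) := by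
    rw [s1]
    refine l1.add (Ld.C_mul _ ?_)
    have := l0.pow q
    simpa using this
  have tt : ∀ {e : ℝ} {P Q : R2}, Ld 1 q e P Q → Ld 1 q e (ψ.symm P) (ψ.symm Q) := by
    intro e P Q hP
    have := Ld.subst one_pos (ψ.symm : R2 →+* R2) (ψ.symm : R2 →+* R2) id (ae_C _) (ae_C _) t0 t1 hP
    simpa using this
  have hU' := tt hU
  have hV' : Sp 1 q (Set.Iio (l * q)) (cj ψ σ (X 1)) := by
    have e : cj ψ σ (X 1) = ψ.symm (σ (X 1) - C c * σ (X 0) ^ q) := by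
      rw [cj_apply, p1]; simp only [map_sub, map_mul, map_pow, h.c, starRingEnd_self_apply]
    rw [e]
    apply Ld.lt
    have h3 := (hU.pow q).C_mul c
    rw [mul_comm (q : ℝ)] at h3
    have := tt (hV.sub h3)
    rwa [sub_self, map_zero] at this
  have e0 : cj ψ σ (X 0) = ψ.symm (σ (X 0)) := by rw [cj_apply, p0]
  rw [← e0] at hU'
  have hz : ∀ m : Fin 2 →₀ ℕ, m 0 = L → m 1 = 0 → coeff m (cj ψ σ (X 0)) = 0 := by
    intro m hm0 hm1
    have hw : wt 1 q m = l := by simp [wt, hm0, hm1, hL]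
    rw [← hU'.coeff hw]
    have ev1 : eval ![(1:ℂ), 0] (ψ.symm F) = 0 := by
      have : (aeval ![(1:ℂ), 0]).comp (ψ.symm : R2 →ₐ[ℂ] R2) = (aeval ![1, starRingEnd ℂ c] : R2 →ₐ[ℂ] ℂ) := by
        apply MvPolynomial.algHom_ext
        intro i
        fin_cases i
        · simp [s0]
        · simp [s1]
      have := DFunLike.congr_fun this F
      change eval ![(1:ℂ), 0] (ψ.symm F) = eval ![1, starRingEnd ℂ c] F at this
      rw [this, ← hS, eval_eq']
      apply Finset.sum_congr rfl
      intro k _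
      simp [Fin.prod_univ_two]
    rw [eval_eq'] at ev1
    by_contra hne
    rw [Finset.sum_eq_single m] at ev1
    · simp [Fin.prod_univ_two, hm1] at ev1
      exact hne ev1
    · intro b hb hbm
      have hb1 : b 1 ≠ 0 := by
        intro hb1
        apply hbm
        have := hU'.1 b (mem_support_iff.mp hb)
        simp [wt, hb1, hL] at this
        exact fin2_ext (by omega) (by omega)
      simp [Fin.prod_univ_two, hb1]
    · intro h; simp at h; simp [h]
  intro w0 w1 l' hE
  obtain ⟨g0, g1, -, ⟨m, hm, hm'⟩, -, ⟨n, hn, hn'⟩⟩ := hE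
  by_contra hll
  push Not at hll
  rcases le_or_gt (q * w0) w1 with hw | hw
  · have h5 := hV' n hn
    simp only [Set.mem_Iio, wt] at h5 hn'
    have n0 : (0:ℝ) ≤ n 0 := by positivity
    have a1 : (n 0 : ℝ) * (q * w0) ≤ n 0 * w1 := by gcongr
    have a2 : q * (l * w1) ≤ q * (l' * w1) := by gcongr
    have a3 : ((n 0 : ℝ) * 1 + n 1 * q) * w1 < l * q * w1 := by gcongr
    nlinarith
  · have h5 := hU'.le m hm
    simp only [Set.mem_Iic, wt] at h5 hm'
    have a2 : l * w0 ≤ l' * w0 := by gcongr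
    have a3 : ((m 0 : ℝ) * 1 + m 1 * q) * w0 ≤ l * w0 := by gcongr
    rcases Nat.eq_zero_or_pos (m 1) with m1 | m1
    · rw [m1] at hm' h5
      simp at hm' h5
      have : l ≤ m 0 := by
        rcases hm' with h | h <;> linarith
      have : (m 0 : ℝ) = L := by linarith
      exact hm (hz m (by exact_mod_cast this) m1)
    · have m1' : (0:ℝ) < m 1 := by exact_mod_cast m1
      have a4 : (m 1 : ℝ) * w1 < m 1 * (q * w0) := by gcongr
      nlinarith

end RF

namespace RF

lemma pq_one {d : ℕ} (hd : 3 ≤ d) {σ : R2 →+* R2} (h : Adm d σ) {w0 w1 l : ℝ}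
    (hl : 1 < l) (he : Eig (σ (X 0)) (σ (X 1)) w0 w1 l) :
    (∃ q : ℕ, 1 ≤ q ∧ w1 = q * w0) ∨ (∃ p : ℕ, 1 ≤ p ∧ w0 = p * w1) := by
  obtain ⟨σb, hb, h0, h1, hU, hV⟩ := leads he
  obtain ⟨p0, p1, -⟩ := he
  obtain ⟨ξ, hx, hs⟩ := h.sq
  obtain ⟨c, hc, hJ⟩ := h.jac (by omega)
  have key := key_ineq p0 p1 hl σ σb _ (fun c hc => by simpa using hc) h.c hb h0 h1 hU hV c hc hJ ξ (by rw [hs, dg_0])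
  set S := (σb (X 0)).support
  have hw : ∀ m ∈ S, (m 0 : ℝ) * w0 + m 1 * w1 = l * w0 := fun m hm => h0.1 m (mem_support_iff.mp hm)
  have inj : ∀ m ∈ S, ∀ n ∈ S, m 0 = n 0 → m = n := by
    intro m hm n hn e
    have a1 := hw m hm
    have a2 := hw n hn
    rw [e, ← a2] at a1
    have a3 : (m 1 : ℝ) * w1 = n 1 * w1 := by linarith
    have a4 := mul_right_cancel₀ p1.ne' a3
    exact fin2_ext e (by exact_mod_cast a4)
  have card2 : 1 < S.card := by
    by_contra hh
    have : (S.card : ℝ) ≤ 1 := by exact_mod_cast (not_lt.mp hh)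
    nlinarith
  obtain ⟨m, hm, n, hn, hmn⟩ := Finset.one_lt_card.mp card2
  obtain ⟨p, q, hp, hq, hpq, hcop⟩ : ∃ p q : ℕ, 1 ≤ p ∧ 1 ≤ q ∧ p * w1 = q * w0 ∧ Nat.Coprime q p := by
    have a1 := hw m hm
    have a2 := hw n hn
    have ne : (n 1 : ℝ) - m 1 ≠ 0 := by
      intro h3
      apply hmn
      apply inj m hm n hn
      have h4 : (n 1 : ℝ) = m 1 := by linarith
      rw [h4, ← a1] at a2
      have a4 := mul_right_cancel₀ p0.ne' (add_right_cancel a2)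
      exact_mod_cast a4.symm
    let r : ℚ := ((m 0 : ℚ) - n 0) / ((n 1 : ℚ) - m 1)
    have hr : w1 = r * w0 := by
      simp only [r]; push_cast; field_simp; linarith
    have rpos : 0 < r := by
      have : (0:ℝ) < r := by by_contra hh; push Not at hh; nlinarith
      exact_mod_cast this
    refine ⟨r.den, r.num.natAbs, r.den_pos, ?_, ?_, r.reduced⟩
    · have := Rat.num_pos.mpr rpos; omega
    · have e : ((r.num.natAbs : ℕ) : ℝ) = r.num := by
        have := Rat.num_pos.mpr rpos
        rw [← Int.cast_natCast, Int.natAbs_of_nonneg this.le]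
      have e2 : (r : ℝ) * r.den = r.num := by exact_mod_cast Rat.mul_den_eq_num r
      rw [e, ← e2, hr]; ring
  have hdvd : ∀ m ∈ S, ∀ n ∈ S, (m 0 : ℤ) ≡ n 0 [ZMOD q] := by
    intro m hm n hn
    have a1 := hw m hm
    have a2 := hw n hn
    have a3 : (((n 0 : ℝ) - m 0) * p) * w0 = (((m 1 : ℝ) - n 1) * q) * w0 := by
      linear_combination p * a2 - p * a1 + (m 1 - n 1 : ℝ) * hpq
    have a4 := mul_right_cancel₀ p0.ne' a3
    have a5 : ((n 0 : ℤ) - m 0) * p = ((m 1 : ℤ) - n 1) * q := by exact_mod_cast a4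
    have a6 : (q : ℤ) ∣ ((n 0 : ℤ) - m 0) * p := ⟨_, by rw [a5, mul_comm]⟩
    have a7 : (q : ℤ) ∣ (n 0 : ℤ) - m 0 := (Nat.isCoprime_iff_coprime.mpr hcop).dvd_of_dvd_mul_right a6
    exact (Int.modEq_iff_dvd).mpr a7
  have hcard : S.card ≤ ⌊l⌋₊ / q + 1 := by
    have : S.card ≤ (Finset.range (⌊l⌋₊ / q + 1)).card := by
      apply Finset.card_le_card_of_injOn (fun m => m 0 / q)
      · intro m hm
        have hm : m ∈ S := hm
        simp only [Finset.coe_range, Set.mem_Iio, Nat.lt_succ_iff]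
        apply Nat.div_le_div_right
        apply Nat.le_floor
        have a1 := hw m hm
        have : (0:ℝ) ≤ m 1 * w1 := by positivity
        by_contra hh
        push Not at hh
        nlinarith
      · intro m hm n hn e
        apply inj m hm n hn
        have := hdvd m hm n hn
        rw [Int.natCast_modEq_iff] at this
        simp only at e
        rw [← Nat.div_add_mod (m 0) q, ← Nat.div_add_mod (n 0) q, e, this]
    simpa using this
  have hcl : ((S.card : ℝ) - 1) * q ≤ l := by
    have a1 : (S.card - 1) * q ≤ ⌊l⌋₊ := by
      refine le_trans (Nat.mul_le_mul_right q (show S.card - 1 ≤ ⌊l⌋₊ / q by omega)) (Nat.div_mul_le_self _ _)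
    have a2 : ((S.card - 1 : ℕ) : ℝ) * q ≤ ⌊l⌋₊ := by exact_mod_cast a1
    rw [Nat.cast_sub card2.le] at a2
    exact le_trans (by simpa using a2) (Nat.floor_le (by linarith))
  have qp : (0:ℝ) < q := by exact_mod_cast hq
  have pp : (0:ℝ) < p := by exact_mod_cast hp
  have fin : (p:ℝ) * q * (l + 1) ≤ l * (p + q) := by
    have b1 : w0 * (l + 1) * q ≤ (((S.card : ℝ) - 1) * q) * (w0 + w1) := by nlinarith
    have b2 : (((S.card : ℝ) - 1) * q) * (w0 + w1) ≤ l * (w0 + w1) := by gcongr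
    have b3 : (w0 * (l + 1) * q) * p ≤ (l * (w0 + w1)) * p := mul_le_mul_of_nonneg_right (b1.trans b2) pp.le
    have b4 : ((p:ℝ) * q * (l + 1)) * w0 ≤ (l * (p + q)) * w0 := by
      have : (l * (w0 + w1)) * p = (l * (p + q)) * w0 := by linear_combination l * hpq
      linarith
    exact le_of_mul_le_mul_right b4 p0
  by_cases e1 : p = 1
  · left; exact ⟨q, hq, by rw [← hpq, e1]; simp⟩
  by_cases e2 : q = 1
  · right; exact ⟨p, hp, by rw [hpq, e2]; simp⟩
  exfalso
  have p2 : (2:ℝ) ≤ p := by exact_mod_cast (show 2 ≤ p by omega)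
  have q2 : (2:ℝ) ≤ q := by exact_mod_cast (show 2 ≤ q by omega)
  have : (p:ℝ) + q ≤ p * q := by nlinarith
  have : l * ((p:ℝ) + q) ≤ l * (p * q) := by gcongr
  nlinarith

lemma cj_sw_0 (σ : R2 →+* R2) : cj sw σ (X 0) = sw (σ (X 1)) := by rw [cj_apply, sw_0, sw_symm]
lemma cj_sw_1 (σ : R2 →+* R2) : cj sw σ (X 1) = sw (σ (X 0)) := by rw [cj_apply, sw_1, sw_symm]

lemma base {d : ℕ} (hd : 3 ≤ d) {σ : R2 →+* R2} (h : Adm d σ)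
    (hE : ∀ w0 w1 l, Eig (σ (X 0)) (σ (X 1)) w0 w1 l → l ≤ 1) : Red d σ := by
  by_cases b0 : ∀ m, coeff m (σ (X 0)) ≠ 0 → m 1 = 0
  · exact red_bdry hd h b0
  by_cases b1 : ∀ m, coeff m (σ (X 1)) ≠ 0 → m 0 = 0
  · apply Red.of_cj (Nme_sw d)
    apply red_bdry hd (h.cj (Nme_sw d))
    intro m hm
    rw [cj_sw_0, coeff_sw] at hm
    simpa using b1 _ hm
  push Not at b0 b1
  obtain ⟨m, hm, hm1⟩ := b0
  obtain ⟨k, hk, hk1⟩ := b1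
  obtain ⟨w0, w1, l, he⟩ := Eig.ex _ _ m k hm (by omega) hk (by omega)
  obtain ⟨⟨a, ha⟩, ⟨b, hb⟩⟩ := term_lin hd (h.cls (by omega)) he (hE _ _ _ he) m k hm (by omega) hk (by omega)
  exact red_anti hd h ha hb

lemma descent_aux {d : ℕ} (hd : 3 ≤ d) (n : ℕ) : ∀ {σ : R2 →+* R2}, Adm d σ →
    (∀ w0 w1 l, Eig (σ (X 0)) (σ (X 1)) w0 w1 l → l < n + 1) → Red d σ := by
  induction n with
  | zero =>
    intro σ h hE
    exact base hd h (fun w0 w1 l he => by simpa using (hE _ _ _ he).le)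
  | succ n ih =>
    intro σ h hE
    by_cases hh : ∃ w0 w1 l, Eig (σ (X 0)) (σ (X 1)) w0 w1 l ∧ 1 < l
    · obtain ⟨w0, w1, l, he, hl⟩ := hh
      have hln := hE _ _ _ he
      have fin : ∀ {σ' : R2 →+* R2}, Adm d σ' → ∀ q : ℕ, 1 ≤ q → Eig (σ' (X 0)) (σ' (X 1)) 1 q l → Red d σ' := by
        intro σ' h' q hq he'
        obtain ⟨⟨L, hL⟩, ψ, hψ, hlt⟩ := step hd h' hq hl he'
        apply Red.of_cj hψ
        apply ih (h'.cj hψ)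
        intro w0 w1 l' h3
        refine lt_of_lt_of_le (hlt _ _ _ h3) ?_
        rw [hL] at hln ⊢
        have : L < n + 1 + 1 := by exact_mod_cast hln
        exact_mod_cast (show L ≤ n + 1 by omega)
      rcases pq_one hd h hl he with ⟨q, hq, e⟩ | ⟨p, hp, e⟩
      · apply fin h q hq
        have p0 := he.1
        have := he.smul (inv_pos.mpr p0)
        rw [e] at this
        convert this using 1 <;> field_simp
      · apply Red.of_cj (Nme_sw d)
        apply fin (h.cj (Nme_sw d)) p hp
        have p0 := he.2.1
        have := he.sw.smul (inv_pos.mpr p0)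
        rw [cj_sw_0, cj_sw_1]
        rw [e] at this
        convert this using 1 <;> field_simp
    · push Not at hh
      exact base hd h hh

lemma descent {d : ℕ} (hd : 3 ≤ d) {σ : R2 →+* R2} (h : Adm d σ) : Red d σ := by
  obtain ⟨n, hn⟩ := Eig.bdd (σ (X 0)) (σ (X 1))
  exact descent_aux hd n h hn

end RF

namespace RF

section
variable (A : Type) [CommRing A] [Algebra ℝ A]

noncomputable def cA : (ℂ ⊗[ℝ] A) ≃ₐ[ℝ] (ℂ ⊗[ℝ] A) := Algebra.TensorProduct.congr Complex.conjAe AlgEquiv.refl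

variable {A}
@[simp] lemma cA_tmul (z : ℂ) (a : A) : cA A (z ⊗ₜ a) = (starRingEnd ℂ z) ⊗ₜ a := by
  simp [cA]

lemma cA_cA (t : ℂ ⊗[ℝ] A) : cA A (cA A t) = t := by
  induction t with
  | zero => simp
  | add x y hx hy => simp [hx, hy]
  | tmul z a => simp

lemma decompA (t : ℂ ⊗[ℝ] A) : ∃ a b : A, t = 1 ⊗ₜ a + Complex.I ⊗ₜ b := by
  induction t with
  | zero => exact ⟨0, 0, by simp⟩
  | add x y hx hy =>
    obtain ⟨a, b, rfl⟩ := hx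
    obtain ⟨a', b', rfl⟩ := hy
    exact ⟨a + a', b + b', by rw [TensorProduct.tmul_add, TensorProduct.tmul_add]; abel⟩
  | tmul z a =>
    refine ⟨z.re • a, z.im • a, ?_⟩
    rw [← TensorProduct.smul_tmul, ← TensorProduct.smul_tmul, ← TensorProduct.add_tmul]
    congr 1
    apply Complex.ext <;> simp

lemma fixA (t : ℂ ⊗[ℝ] A) : cA A t = t ↔ t ∈ (Algebra.TensorProduct.includeRight : A →ₐ[ℝ] ℂ ⊗[ℝ] A).range := by
  constructor
  · intro h
    obtain ⟨a, b, rfl⟩ := decompA t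
    refine ⟨a, ?_⟩
    simp [TensorProduct.neg_tmul] at h
    have h2 : (2 : ℝ) • (Complex.I ⊗ₜ[ℝ] b) = 0 := by
      rw [two_smul]; nth_rw 1 [← h]; simp
    have h3 := (smul_eq_zero.mp h2).resolve_left (by norm_num)
    simp [h3]
  · rintro ⟨a, rfl⟩
    simp

lemma incl_inj : Function.Injective (Algebra.TensorProduct.includeRight : A →ₐ[ℝ] ℂ ⊗[ℝ] A) :=
  Algebra.TensorProduct.includeRight_injective (algebraMap ℝ ℂ).injective

variable {A' : Type} [CommRing A'] [Algebra ℝ A']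

lemma iso_of (Θ : (ℂ ⊗[ℝ] A) ≃ₐ[ℂ] (ℂ ⊗[ℝ] A')) (h : ∀ t, cA A' (Θ t) = Θ (cA A t)) : Nonempty (A ≃ₐ[ℝ] A') := by
  let e1 := AlgEquiv.ofInjective _ (incl_inj (A := A))
  let e2 := AlgEquiv.ofInjective _ (incl_inj (A := A'))
  let Θ' : (ℂ ⊗[ℝ] A) ≃ₐ[ℝ] (ℂ ⊗[ℝ] A') := Θ.restrictScalars ℝ
  let e3 := Θ'.subalgebraMap (Algebra.TensorProduct.includeRight : A →ₐ[ℝ] ℂ ⊗[ℝ] A).range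
  have e : Subalgebra.map (Θ' : (ℂ ⊗[ℝ] A) →ₐ[ℝ] (ℂ ⊗[ℝ] A')) (Algebra.TensorProduct.includeRight : A →ₐ[ℝ] ℂ ⊗[ℝ] A).range
      = (Algebra.TensorProduct.includeRight : A' →ₐ[ℝ] ℂ ⊗[ℝ] A').range := by
    ext t
    rw [← fixA, Subalgebra.mem_map]
    constructor
    · rintro ⟨s, hs, rfl⟩
      rw [← fixA] at hs
      change cA A' (Θ s) = Θ s
      rw [h, hs]
    · intro ht
      refine ⟨Θ.symm t, ?_, Θ.apply_symm_apply t⟩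
      rw [← fixA]
      apply Θ.injective
      rw [← h, Θ.apply_symm_apply, ht]
  exact ⟨e1.trans (e3.trans ((Subalgebra.equivOfEq _ _ e).trans e2.symm))⟩

variable {d : ℕ}

noncomputable def sg (e : (ℂ ⊗[ℝ] A) ≃ₐ[ℂ] BB d) : BB d ≃+* BB d :=
  (e.symm : BB d ≃+* ℂ ⊗[ℝ] A).trans ((cA A : (ℂ ⊗[ℝ] A) ≃+* (ℂ ⊗[ℝ] A)).trans (e : (ℂ ⊗[ℝ] A) ≃+* BB d))

lemma sg_apply (e : (ℂ ⊗[ℝ] A) ≃ₐ[ℂ] BB d) (b) : sg e b = e (cA A (e.symm b)) := rfl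

lemma sg_C (e : (ℂ ⊗[ℝ] A) ≃ₐ[ℂ] BB d) (c : ℂ) : sg e (algebraMap ℂ _ c) = algebraMap ℂ _ (starRingEnd ℂ c) := by
  rw [sg_apply, AlgEquiv.commutes, Algebra.TensorProduct.algebraMap_apply, cA_tmul, ← AlgEquiv.commutes e, Algebra.TensorProduct.algebraMap_apply]
  simp

lemma sg_sg (e : (ℂ ⊗[ℝ] A) ≃ₐ[ℂ] BB d) (b) : sg e (sg e b) = b := by
  simp [sg_apply, cA_cA]

lemma iso_of_sg (e : (ℂ ⊗[ℝ] A) ≃ₐ[ℂ] BB d) (e' : (ℂ ⊗[ℝ] A') ≃ₐ[ℂ] BB d) (θ : BB d ≃ₐ[ℂ] BB d)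
    (h : ∀ i, sg e' (θ (bb d i)) = θ (sg e (bb d i))) : Nonempty (A ≃ₐ[ℝ] A') := by
  have h' : ∀ b, sg e' (θ b) = θ (sg e b) := by
    intro b
    refine ext_BB ((sg e' : BB d →+* BB d).comp (θ : BB d →+* BB d)) ((θ : BB d →+* BB d).comp (sg e : BB d →+* BB d)) ?_ h b
    intro c
    change sg e' (θ _) = θ (sg e _)
    rw [AlgEquiv.commutes, sg_C, sg_C, AlgEquiv.commutes]
  apply iso_of ((e.trans θ).trans e'.symm)
  intro t
  have := h' (e t)
  rw [sg_apply, sg_apply, AlgEquiv.symm_apply_apply] at this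
  apply e'.injective
  simpa using this

lemma sg_of_iso (e : (ℂ ⊗[ℝ] A) ≃ₐ[ℂ] BB d) (e' : (ℂ ⊗[ℝ] A') ≃ₐ[ℂ] BB d) (φ : A ≃ₐ[ℝ] A') :
    ∃ θ : BB d ≃ₐ[ℂ] BB d, ∀ b, sg e' (θ b) = θ (sg e b) := by
  let Φ : (ℂ ⊗[ℝ] A) ≃ₐ[ℂ] (ℂ ⊗[ℝ] A') := Algebra.TensorProduct.congr AlgEquiv.refl φ
  have hΦ : ∀ t, cA A' (Φ t) = Φ (cA A t) := by
    intro t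
    induction t with
    | zero => simp
    | add x y hx hy => simp only [map_add, hx, hy]
    | tmul z a => simp [Φ]
  refine ⟨(e.symm.trans Φ).trans e', fun b => ?_⟩
  simp [sg_apply, hΦ]
end

lemma hom_ext2 (f g : R2 →+* R2) (hc : ∀ c, f (C c) = g (C c)) (h0 : f (X 0) = g (X 0)) (h1 : f (X 1) = g (X 1)) (r : R2) :
    f r = g r := by
  have : f = g := by
    apply MvPolynomial.ringHom_ext hc
    intro i; fin_cases i
    · exact h0
    · exact h1
  rw [this]

lemma range_map (d : ℕ) (hd : 0 < d) (ψ : R2 ≃ₐ[ℂ] R2) (hψ : Nme d ψ) (b : BB d) : ψ (iota d b) ∈ (iota d).range := by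
  apply mem_range_iota d hd
  intro ξ hx
  rcases hψ with h | h
  · have := h ξ hx (iota d b)
    rw [De_iota d ξ hx hd] at this
    exact this.symm
  · have := h _ (inv_root hx) (iota d b)
    rw [De_iota d _ (inv_root hx) hd, inv_inv] at this
    exact this.symm

lemma theta_ex (d : ℕ) (hd : 0 < d) (ψ : R2 ≃ₐ[ℂ] R2) (hψ : Nme d ψ) :
    ∃ θ : BB d ≃ₐ[ℂ] BB d, ∀ b, iota d (θ b) = ψ (iota d b) := by
  have hψs := hψ.symm
  let j := AlgEquiv.ofInjective _ (iota_inj d hd)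
  have e : Subalgebra.map (ψ : R2 →ₐ[ℂ] R2) (iota d).range = (iota d).range := by
    ext t
    rw [Subalgebra.mem_map]
    constructor
    · rintro ⟨_, ⟨b, rfl⟩, rfl⟩
      exact range_map d hd ψ hψ b
    · rintro ⟨b, rfl⟩
      exact ⟨ψ.symm (iota d b), range_map d hd ψ.symm hψs b, ψ.apply_symm_apply _⟩
  refine ⟨j.trans ((ψ.subalgebraMap _).trans ((Subalgebra.equivOfEq _ _ e).trans j.symm)), fun b => ?_⟩
  have : ∀ x, iota d (j.symm x) = x := by
    intro x
    have := j.apply_symm_apply x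
    exact congrArg Subtype.val this
  simp only [AlgEquiv.trans_apply, this]
  rfl

lemma lift_adm {A : Type} [CommRing A] [Algebra ℝ A] (d : ℕ) (hd : 0 < d) (e : (ℂ ⊗[ℝ] A) ≃ₐ[ℂ] BB d) :
    ∃ σ, Adm d σ ∧ ∀ b, σ (iota d b) = iota d (sg e b) := by
  obtain ⟨σ, hc, hb, hcl⟩ := lift d hd (sg e) (starRingAut : ℂ ≃+* ℂ) (fun c => sg_C e c)
  have hc : ∀ c, σ (C c) = C (starRingEnd ℂ c) := hc
  refine ⟨σ, ⟨hc, ?_, ?_⟩, hb⟩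
  · rcases hcl with h | h
    · right
      intro ξ hx r
      refine hom_ext2 (σ.comp (De ξ : R2 →+* R2)) ((De ξ⁻¹ : R2 →+* R2).comp σ) ?_ ?_ ?_ r
      · intro c
        simp [hc]
      · change σ (De ξ (X 0)) = De ξ⁻¹ (σ (X 0))
        rw [(h _ (inv_root hx)).1, dg_0, map_mul, hc, conj_root hd hx]
      · change σ (De ξ (X 1)) = De ξ⁻¹ (σ (X 1))
        rw [(h _ (inv_root hx)).2, dg_1, map_mul, hc, map_inv₀, conj_root hd hx]
    · left
      intro ξ hx r
      refine hom_ext2 (σ.comp (De ξ : R2 →+* R2)) ((De ξ : R2 →+* R2).comp σ) ?_ ?_ ?_ r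
      · intro c
        simp [hc]
      · change σ (De ξ (X 0)) = De ξ (σ (X 0))
        rw [(h _ hx).1, dg_0, map_mul, hc, conj_root hd hx]
      · change σ (De ξ (X 1)) = De ξ (σ (X 1))
        rw [(h _ hx).2, dg_1, map_mul, hc, map_inv₀, conj_root hd hx, inv_inv]
  · obtain ⟨ζ, hz, h0, h1⟩ := lift_id d hd (σ.comp σ) (fun b => by simp [hb, sg_sg])
    refine ⟨ζ, hz, fun r => ?_⟩
    refine hom_ext2 (σ.comp σ) (De ζ : R2 →+* R2) ?_ ?_ ?_ r
    · intro c; simp [hc]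
    · rw [h0]; simp
    · rw [h1]; simp

/-- main classification in terms of the involution on `BB d` -/
lemma classify {A : Type} [CommRing A] [Algebra ℝ A] (d : ℕ) (hd : 3 ≤ d) (e : (ℂ ⊗[ℝ] A) ≃ₐ[ℂ] BB d) :
    ∃ θ : BB d ≃ₐ[ℂ] BB d, sg e (θ (bb d 2)) = θ (bb d 2) ∧
     ((sg e (θ (bb d 0)) = θ (bb d 0) ∧ sg e (θ (bb d 1)) = θ (bb d 1)) ∨
      (sg e (θ (bb d 0)) = θ (bb d 1) ∧ sg e (θ (bb d 1)) = θ (bb d 0)) ∨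
      (Even d ∧ sg e (θ (bb d 0)) = θ (-bb d 1) ∧ sg e (θ (bb d 1)) = θ (-bb d 0))) := by
  obtain ⟨σ, hσ, hb⟩ := lift_adm d (by omega) e
  obtain ⟨ψ, hψ, hT⟩ := descent hd hσ
  obtain ⟨θ, hθ⟩ := theta_ex d (by omega) ψ hψ
  have inj := iota_inj d (by omega)
  have key : ∀ b b', cj ψ σ (iota d b) = iota d b' → sg e (θ b) = θ b' := by
    intro b b' h
    apply inj
    rw [← hb, hθ, hθ, ← h, cj_apply, AlgEquiv.apply_symm_apply]
  refine ⟨θ, ?_, ?_⟩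
  · apply key
    rcases hT with ⟨h0, h1⟩ | ⟨s, hs, -, h0, h1⟩
    · simp [h0, h1]
    · simp only [iota_2, map_mul, h0, h1]
      rw [mul_mul_mul_comm, ← C_mul, inv_mul_cancel₀ hs, C_1, one_mul, mul_comm]
  · rcases hT with ⟨h0, h1⟩ | ⟨s, hs, hsd, h0, h1⟩
    · left
      exact ⟨key _ _ (by simp [h0]), key _ _ (by simp [h1])⟩
    · right
      rcases hsd with hsd | ⟨hsd, hev⟩
      · left
        refine ⟨key _ _ ?_, key _ _ ?_⟩
        · simp only [iota_0, iota_1, map_pow, h0]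
          rw [mul_pow, ← C_pow, inv_pow, hsd]; simp
        · simp only [iota_0, iota_1, map_pow, h1]
          rw [mul_pow, ← C_pow, hsd]; simp
      · right
        refine ⟨hev, key _ _ ?_, key _ _ ?_⟩
        · simp only [iota_0, iota_1, map_pow, h0, map_neg]
          rw [mul_pow, ← C_pow, inv_pow, hsd]; simp
        · simp only [iota_0, iota_1, map_pow, h1, map_neg]
          rw [mul_pow, ← C_pow, hsd]; simp

end RF

namespace RF
abbrev AQ (p : MvPolynomial (Fin 3) ℝ) := MvPolynomial (Fin 3) ℝ ⧸ Ideal.span {p}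

noncomputable def xr (p : MvPolynomial (Fin 3) ℝ) (i : Fin 3) : AQ p := Ideal.Quotient.mk _ (X i)

lemma xr_mk (p q : MvPolynomial (Fin 3) ℝ) : (Ideal.Quotient.mk (Ideal.span {p}) q) = aeval (xr p) q := by
  induction q using MvPolynomial.induction_on with
  | C a => simp only [aeval_C]; rfl
  | add p q hp hq => simp only [map_add, hp, hq]
  | mul_X p n hp => simp only [map_mul, hp, aeval_X]; rfl

lemma xr_rel (p : MvPolynomial (Fin 3) ℝ) : aeval (xr p) p = 0 := by
  rw [← xr_mk, Ideal.Quotient.eq_zero_iff_mem]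
  exact Ideal.subset_span rfl

lemma AQ_ext {p : MvPolynomial (Fin 3) ℝ} {S : Type*} [CommRing S] [Algebra ℝ S] {f g : AQ p →ₐ[ℝ] S}
    (h : ∀ i, f (xr p i) = g (xr p i)) : f = g := by
  apply AlgHom.ext
  intro b
  obtain ⟨q, rfl⟩ := Ideal.Quotient.mk_surjective b
  rw [xr_mk]
  induction q using MvPolynomial.induction_on with
  | C a => rw [aeval_C, AlgHom.commutes, AlgHom.commutes]
  | add p q hp hq => simp only [map_add, hp, hq]
  | mul_X p i hp => simp only [map_mul, hp, aeval_X, h]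

lemma AQ_lift (p : MvPolynomial (Fin 3) ℝ) {S : Type*} [CommRing S] [Algebra ℝ S] (v : Fin 3 → S) (hv : aeval v p = 0) :
    ∃ f : AQ p →ₐ[ℝ] S, ∀ i, f (xr p i) = v i := by
  refine ⟨Ideal.Quotient.liftₐ _ (aeval v) ?_, fun i => ?_⟩
  · intro a ha
    have : Ideal.span {p} ≤ RingHom.ker (aeval (R := ℝ) v) := by
      rw [Ideal.span_singleton_le_iff_mem]; exact hv
    exact this ha
  · exact aeval_X v i

lemma BB_lift (d : ℕ) {S : Type*} [CommRing S] [Algebra ℂ S] (v : Fin 3 → S) (hv : v 0 * v 1 = v 2 ^ d) :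
    ∃ f : BB d →ₐ[ℂ] S, ∀ i, f (bb d i) = v i := by
  refine ⟨Ideal.Quotient.liftₐ _ (aeval v) ?_, fun i => ?_⟩
  · intro a ha
    have : Ideal.span {(X 0 * X 1 : MvPolynomial (Fin 3) ℂ) - X 2 ^ d} ≤ RingHom.ker (aeval (R := ℂ) v) := by
      rw [Ideal.span_singleton_le_iff_mem, RingHom.mem_ker]; simp [hv]
    exact this ha
  · exact aeval_X v i

lemma BB_ext {d : ℕ} {S : Type*} [CommRing S] [Algebra ℂ S] {f g : BB d →ₐ[ℂ] S} (h : ∀ i, f (bb d i) = g (bb d i)) : f = g := by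
  apply AlgHom.ext
  intro b
  exact ext_BB (f : BB d →+* S) (g : BB d →+* S) (fun c => by simp) h b

lemma mkE (d : ℕ) (p : MvPolynomial (Fin 3) ℝ) (a b c e a' b' c' e' : ℂ)
    (h1 : aeval ![a • bb d 0 + b • bb d 1, c • bb d 0 + e • bb d 1, bb d 2] p = 0)
    (h2 : (a' • ((1:ℂ) ⊗ₜ[ℝ] xr p 0) + b' • ((1:ℂ) ⊗ₜ[ℝ] xr p 1)) * (c' • ((1:ℂ) ⊗ₜ[ℝ] xr p 0) + e' • ((1:ℂ) ⊗ₜ[ℝ] xr p 1))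
       = ((1:ℂ) ⊗ₜ[ℝ] xr p 2) ^ d)
    (q1 : a' * a + b' * c = 1) (q2 : a' * b + b' * e = 0) (q3 : c' * a + e' * c = 0) (q4 : c' * b + e' * e = 1)
    (r1 : a * a' + b * c' = 1) (r2 : a * b' + b * e' = 0) (r3 : c * a' + e * c' = 0) (r4 : c * b' + e * e' = 1) :
    ∃ E : (ℂ ⊗[ℝ] AQ p) ≃ₐ[ℂ] BB d, E.symm (bb d 0) = a' • ((1:ℂ) ⊗ₜ[ℝ] xr p 0) + b' • ((1:ℂ) ⊗ₜ[ℝ] xr p 1) ∧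
      E.symm (bb d 1) = c' • ((1:ℂ) ⊗ₜ[ℝ] xr p 0) + e' • ((1:ℂ) ⊗ₜ[ℝ] xr p 1) ∧ E.symm (bb d 2) = (1:ℂ) ⊗ₜ[ℝ] xr p 2 := by
  obtain ⟨f0, hf0⟩ := AQ_lift p _ h1
  obtain ⟨g, hg⟩ := BB_lift d ![a' • ((1:ℂ) ⊗ₜ[ℝ] xr p 0) + b' • ((1:ℂ) ⊗ₜ[ℝ] xr p 1), c' • ((1:ℂ) ⊗ₜ[ℝ] xr p 0) + e' • ((1:ℂ) ⊗ₜ[ℝ] xr p 1), (1:ℂ) ⊗ₜ[ℝ] xr p 2] h2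
  let f : (ℂ ⊗[ℝ] AQ p) →ₐ[ℂ] BB d := Algebra.TensorProduct.lift (Algebra.ofId ℂ _) f0 (fun _ _ => Commute.all _ _)
  have hf : ∀ i, f (1 ⊗ₜ xr p i) = f0 (xr p i) := by intro i; simp [f]
  have g0 := hg 0
  have g1 := hg 1
  have g2 := hg 2
  have k0 := hf0 0
  have k1 := hf0 1
  have k2 := hf0 2
  simp at g0 g1 g2 k0 k1 k2
  refine ⟨AlgEquiv.ofAlgHom f g ?_ ?_, ?_, ?_, ?_⟩
  · apply BB_ext
    intro i
    fin_cases i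
    · simp only [Fin.zero_eta, AlgHom.comp_apply, g0, map_add, map_smul, hf, k0, k1, AlgHom.id_apply]
      linear_combination (norm := module) q1 • bb d 0 + q2 • bb d 1
    · simp only [Fin.mk_one, AlgHom.comp_apply, g1, map_add, map_smul, hf, k0, k1, AlgHom.id_apply]
      linear_combination (norm := module) q3 • bb d 0 + q4 • bb d 1
    · simp [g2, hf, k2]
  · have key : ∀ i, g (f ((1:ℂ) ⊗ₜ[ℝ] xr p i)) = (1:ℂ) ⊗ₜ[ℝ] xr p i := by
      intro i
      fin_cases i
      · change g (f ((1:ℂ) ⊗ₜ[ℝ] xr p 0)) = (1:ℂ) ⊗ₜ[ℝ] xr p 0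
        rw [hf, k0, map_add, map_smul, map_smul, g0, g1]
        linear_combination (norm := module) r1 • ((1:ℂ) ⊗ₜ[ℝ] xr p 0) + r2 • ((1:ℂ) ⊗ₜ[ℝ] xr p 1)
      · change g (f ((1:ℂ) ⊗ₜ[ℝ] xr p 1)) = (1:ℂ) ⊗ₜ[ℝ] xr p 1
        rw [hf, k1, map_add, map_smul, map_smul, g0, g1]
        linear_combination (norm := module) r3 • ((1:ℂ) ⊗ₜ[ℝ] xr p 0) + r4 • ((1:ℂ) ⊗ₜ[ℝ] xr p 1)
      · change g (f ((1:ℂ) ⊗ₜ[ℝ] xr p 2)) = (1:ℂ) ⊗ₜ[ℝ] xr p 2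
        rw [hf, k2, g2]
    have key2 : ∀ q : MvPolynomial (Fin 3) ℝ, g (f ((1:ℂ) ⊗ₜ[ℝ] aeval (xr p) q)) = (1:ℂ) ⊗ₜ[ℝ] aeval (xr p) q := by
      intro q
      induction q using MvPolynomial.induction_on with
      | C r =>
        have : (1:ℂ) ⊗ₜ[ℝ] (aeval (xr p) (C r : MvPolynomial (Fin 3) ℝ)) = (r:ℂ) • ((1:ℂ) ⊗ₜ[ℝ] (1 : AQ p)) := by
          rw [aeval_C, Algebra.algebraMap_eq_smul_one, TensorProduct.tmul_smul, TensorProduct.smul_tmul', TensorProduct.smul_tmul']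
          simp
        rw [this, map_smul, map_smul]
        congr 1
        exact (congrArg g (f.toRingHom.map_one)).trans (g.toRingHom.map_one)
      | add p q hp hq => simp only [map_add, TensorProduct.tmul_add, hp, hq]
      | mul_X q i hp =>
        have : (1:ℂ) ⊗ₜ[ℝ] (aeval (xr p) (q * X i)) = ((1:ℂ) ⊗ₜ[ℝ] (aeval (xr p) q)) * ((1:ℂ) ⊗ₜ[ℝ] xr p i) := by
          rw [map_mul, aeval_X, Algebra.TensorProduct.tmul_mul_tmul, one_mul]
        rw [this, map_mul, map_mul, hp, key]
    apply AlgHom.ext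
    intro t
    change g (f t) = t
    induction t with
    | zero => simp
    | add x y hx hy => rw [map_add, map_add, hx, hy]
    | tmul z y =>
      obtain ⟨q, rfl⟩ := Ideal.Quotient.mk_surjective y
      rw [xr_mk]
      have : z ⊗ₜ[ℝ] (aeval (xr p) q) = z • ((1:ℂ) ⊗ₜ[ℝ] (aeval (xr p) q)) := by
        rw [TensorProduct.smul_tmul', smul_eq_mul, mul_one]
      rw [this, map_smul, map_smul, key2]
  · exact g0
  · exact g1
  · exact g2

end RF

namespace RF
lemma half2 {S : Type*} [CommRing S] [Algebra ℂ S] : (2 : S) * algebraMap ℂ S (1/2) = 1 := by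
  have : algebraMap ℂ S (2 * (1/2)) = algebraMap ℂ S 1 := by congr 1; norm_num
  rw [map_mul, map_one, map_ofNat] at this
  exact this

lemma II2 {S : Type*} [CommRing S] [Algebra ℂ S] : (algebraMap ℂ S Complex.I) ^ 2 = -1 := by
  rw [← map_pow, Complex.I_sq, map_neg, map_one]


section gen
variable {S : Type*} [CommRing S] [Algebra ℂ S] (x y w : S)
lemma a2 (h : x * y = w) : ((1/2:ℂ) • x + (1/2:ℂ) • y)^2 - ((1/2:ℂ) • x + (-(1/2):ℂ) • y)^2 - w = 0 := by
  simp only [Algebra.smul_def, map_neg]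
  linear_combination h + (x * y) * (2 * algebraMap ℂ S (1/2) + 1) * half2 (S := S)
lemma a1 (h : x * y = w) : ((1/2:ℂ) • x + (1/2:ℂ) • y)^2 + ((-(Complex.I * (1/2)):ℂ) • x + (Complex.I * (1/2):ℂ) • y)^2 - w = 0 := by
  simp only [Algebra.smul_def, map_neg, map_mul]
  linear_combination h + (x * y) * (2 * algebraMap ℂ S (1/2) + 1) * half2 (S := S) + (algebraMap ℂ S (1/2) * (x - y)) ^ 2 * II2 (S := S)
lemma a0 (h : x * y = w) : ((1/2:ℂ) • x + (-(1/2):ℂ) • y)^2 + ((-(Complex.I * (1/2)):ℂ) • x + (-(Complex.I * (1/2)):ℂ) • y)^2 + w = 0 := by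
  simp only [Algebra.smul_def, map_neg, map_mul]
  linear_combination -h - (x * y) * (2 * algebraMap ℂ S (1/2) + 1) * half2 (S := S) + (algebraMap ℂ S (1/2) * (x + y)) ^ 2 * II2 (S := S)
lemma b2 (h : x^2 - y^2 - w = 0) : ((1:ℂ) • x + (1:ℂ) • y) * ((1:ℂ) • x + (-1:ℂ) • y) = w := by
  simp only [Algebra.smul_def, map_neg, map_one]
  linear_combination h
lemma b1 (h : x^2 + y^2 - w = 0) : ((1:ℂ) • x + Complex.I • y) * ((1:ℂ) • x + (-Complex.I) • y) = w := by
  simp only [Algebra.smul_def, map_neg, map_one]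
  linear_combination h - y^2 * II2 (S := S)
lemma b0 (h : x^2 + y^2 + w = 0) : ((1:ℂ) • x + Complex.I • y) * ((-1:ℂ) • x + Complex.I • y) = w := by
  simp only [Algebra.smul_def, map_neg, map_one]
  linear_combination -h + y^2 * II2 (S := S)
end gen

lemma rel2 (d : ℕ) : (xr (surf9 d 2) 0)^2 - (xr (surf9 d 2) 1)^2 - (xr (surf9 d 2) 2)^d = 0 := by
  have := xr_rel (surf9 d 2)
  conv at this => enter [1,2]; simp only [surf9]
  simpa using this
lemma rel1 (d : ℕ) : (xr (surf9 d 1) 0)^2 + (xr (surf9 d 1) 1)^2 - (xr (surf9 d 1) 2)^d = 0 := by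
  have := xr_rel (surf9 d 1)
  conv at this => enter [1,2]; simp only [surf9]
  simpa using this
lemma rel0 (d : ℕ) : (xr (surf9 d 0) 0)^2 + (xr (surf9 d 0) 1)^2 + (xr (surf9 d 0) 2)^d = 0 := by
  have := xr_rel (surf9 d 0)
  conv at this => enter [1,2]; simp only [surf9]
  simpa using this

variable {A : Type} [CommRing A] [Algebra ℝ A]
lemma cA_smul (z : ℂ) (t : ℂ ⊗[ℝ] A) : cA A (z • t) = (starRingEnd ℂ z) • cA A t := by
  induction t with
  | zero => simp
  | add x y hx hy => rw [smul_add, map_add, hx, hy, map_add, smul_add]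
  | tmul w y => 
    rw [TensorProduct.smul_tmul', cA_tmul, cA_tmul, TensorProduct.smul_tmul', smul_eq_mul, smul_eq_mul, map_mul]

lemma sg_eq {d : ℕ} (E : (ℂ ⊗[ℝ] A) ≃ₐ[ℂ] BB d) (b c : BB d) : sg E b = c ↔ cA A (E.symm b) = E.symm c := by
  rw [sg_apply]
  constructor
  · intro h; rw [← h, AlgEquiv.symm_apply_apply]
  · intro h; rw [h, AlgEquiv.apply_symm_apply]

lemma E2_ex (d : ℕ) : ∃ E : (ℂ ⊗[ℝ] AQ (surf9 d 2)) ≃ₐ[ℂ] BB d,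
    sg E (bb d 0) = bb d 0 ∧ sg E (bb d 1) = bb d 1 ∧ sg E (bb d 2) = bb d 2 := by
  obtain ⟨E, h0, h1, h2⟩ := mkE d (surf9 d 2) (1/2) (1/2) (1/2) (-(1/2)) 1 1 1 (-1) (by
    simp only [surf9, Matrix.cons_val, map_add, map_sub, map_pow, aeval_X]
    exact a2 _ _ _ (bb_rel d)) (by
    have := congrArg (Algebra.TensorProduct.includeRight : AQ (surf9 d 2) →ₐ[ℝ] ℂ ⊗[ℝ] AQ (surf9 d 2)) (rel2 d)
    simp only [map_sub, map_pow, map_zero, Algebra.TensorProduct.includeRight_apply] at this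
    exact b2 (S := ℂ ⊗[ℝ] AQ (surf9 d 2)) _ _ _ this) (by norm_num) (by norm_num) (by norm_num) (by norm_num) (by norm_num) (by norm_num) (by norm_num) (by norm_num)
  refine ⟨E, ?_, ?_, ?_⟩
  · apply (sg_eq E _ _).mpr
    rw [h0]
    simp only [map_add, cA_smul, cA_tmul, map_one, map_neg]
  · apply (sg_eq E _ _).mpr
    rw [h1]
    simp only [map_add, cA_smul, cA_tmul, map_one, map_neg]
  · apply (sg_eq E _ _).mpr
    rw [h2]
    simp only [map_add, cA_smul, cA_tmul, map_one, map_neg]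

lemma E1_ex (d : ℕ) : ∃ E : (ℂ ⊗[ℝ] AQ (surf9 d 1)) ≃ₐ[ℂ] BB d,
    sg E (bb d 0) = bb d 1 ∧ sg E (bb d 1) = bb d 0 ∧ sg E (bb d 2) = bb d 2 := by
  have hI := Complex.I_sq
  obtain ⟨E, h0, h1, h2⟩ := mkE d (surf9 d 1) (1/2) (1/2) (-(Complex.I * (1/2))) (Complex.I * (1/2)) 1 Complex.I 1 (-Complex.I) (by
    simp only [surf9, Matrix.cons_val, map_add, map_sub, map_pow, aeval_X]
    exact a1 _ _ _ (bb_rel d)) (by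
    have := congrArg (Algebra.TensorProduct.includeRight : AQ (surf9 d 1) →ₐ[ℝ] ℂ ⊗[ℝ] AQ (surf9 d 1)) (rel1 d)
    simp only [map_add, map_sub, map_pow, map_zero, Algebra.TensorProduct.includeRight_apply] at this
    exact b1 (S := ℂ ⊗[ℝ] AQ (surf9 d 1)) _ _ _ this) (by linear_combination (-1/2) * hI) (by linear_combination (1/2) * hI) (by linear_combination (1/2) * hI) (by linear_combination (-1/2) * hI) (by ring) (by ring) (by ring) (by linear_combination (-1) * hI)
  refine ⟨E, ?_, ?_, ?_⟩
  · apply (sg_eq E _ _).mpr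
    rw [h0, h1]
    simp only [map_add, cA_smul, cA_tmul, map_one, map_neg, Complex.conj_I]
  · apply (sg_eq E _ _).mpr
    rw [h1, h0]
    simp only [map_add, cA_smul, cA_tmul, map_one, map_neg, Complex.conj_I, neg_neg]
  · apply (sg_eq E _ _).mpr
    rw [h2]
    simp only [map_add, cA_smul, cA_tmul, map_one, map_neg]

lemma E0_ex (d : ℕ) : ∃ E : (ℂ ⊗[ℝ] AQ (surf9 d 0)) ≃ₐ[ℂ] BB d,
    sg E (bb d 0) = -bb d 1 ∧ sg E (bb d 1) = -bb d 0 ∧ sg E (bb d 2) = bb d 2 := by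
  have hI := Complex.I_sq
  obtain ⟨E, h0, h1, h2⟩ := mkE d (surf9 d 0) (1/2) (-(1/2)) (-(Complex.I * (1/2))) (-(Complex.I * (1/2))) 1 Complex.I (-1) Complex.I (by
    simp only [surf9, Matrix.cons_val, map_add, map_sub, map_pow, aeval_X]
    exact a0 _ _ _ (bb_rel d)) (by
    have := congrArg (Algebra.TensorProduct.includeRight : AQ (surf9 d 0) →ₐ[ℝ] ℂ ⊗[ℝ] AQ (surf9 d 0)) (rel0 d)
    simp only [map_add, map_sub, map_pow, map_zero, Algebra.TensorProduct.includeRight_apply] at this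
    exact b0 (S := ℂ ⊗[ℝ] AQ (surf9 d 0)) _ _ _ this) (by linear_combination (-1/2) * hI) (by linear_combination (-1/2) * hI) (by linear_combination (-1/2) * hI) (by linear_combination (-1/2) * hI) (by ring) (by ring) (by ring) (by linear_combination (-1) * hI)
  refine ⟨E, ?_, ?_, ?_⟩
  · apply (sg_eq E _ _).mpr
    rw [map_neg, h0, h1]
    simp only [map_add, cA_smul, cA_tmul, map_one, map_neg, Complex.conj_I]
    module
  · apply (sg_eq E _ _).mpr
    rw [map_neg, h1, h0]
    simp only [map_add, cA_smul, cA_tmul, map_one, map_neg, Complex.conj_I, neg_neg]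
    module
  · apply (sg_eq E _ _).mpr
    rw [h2]
    simp only [map_add, cA_smul, cA_tmul, map_one, map_neg]
end RF

namespace RF
lemma noniso {A A' : Type} [CommRing A] [Algebra ℝ A] [CommRing A'] [Algebra ℝ A'] (d : ℕ) (hd : 3 ≤ d)
    (E : (ℂ ⊗[ℝ] A) ≃ₐ[ℂ] BB d) (E' : (ℂ ⊗[ℝ] A') ≃ₐ[ℂ] BB d) (κ : ℂ)
    (h0 : sg E (bb d 0) = algebraMap ℂ (BB d) κ * bb d 1) (h' : ∀ i, sg E' (bb d i) = bb d i)
    (φ : A ≃ₐ[ℝ] A') : False := by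
  have hd0 : 0 < d := by omega
  obtain ⟨θ, hθ⟩ := sg_of_iso E E' φ
  obtain ⟨ψ, _, hψ, hcls⟩ := lift d hd0 (θ : BB d ≃+* BB d) (RingEquiv.refl ℂ) (fun c => by simp)
  set U := ψ (X 0) with hU
  set V := ψ (X 1) with hV
  have u : iota d (θ (bb d 0)) = U ^ d := by
    have := hψ (bb d 0)
    rw [iota_0, map_pow] at this
    exact this.symm
  have v : iota d (θ (bb d 1)) = V ^ d := by
    have := hψ (bb d 1)
    rw [iota_1, map_pow] at this
    exact this.symm
  have hcc : ∀ b, iota d (sg E' b) = MvPolynomial.map (starRingEnd ℂ) (iota d b) := by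
    intro b
    refine ext_BB ((iota d : BB d →+* R2).comp (sg E' : BB d →+* BB d))
      ((MvPolynomial.map (starRingEnd ℂ)).comp (iota d : BB d →+* R2)) ?_ ?_ b
    · intro c
      change iota d (sg E' (algebraMap ℂ _ c)) = MvPolynomial.map (starRingEnd ℂ) (iota d (algebraMap ℂ _ c))
      rw [sg_C, AlgHom.commutes, AlgHom.commutes]
      exact (map_C _ _).symm
    · intro i
      change iota d (sg E' (bb d i)) = MvPolynomial.map (starRingEnd ℂ) (iota d (bb d i))
      rw [h' i]
      fin_cases i
      · simp
      · simp
      · simp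
  obtain ⟨t, ht⟩ := IsAlgClosed.exists_pow_nat_eq κ hd0
  have k1 : (MvPolynomial.map (starRingEnd ℂ) U) ^ d = (C t * V) ^ d := by
    rw [← map_pow, ← u, ← hcc, hθ, h0, map_mul, AlgEquiv.commutes, map_mul, AlgHom.commutes, v, mul_pow, ← C_pow, ht]
    rfl
  obtain ⟨ζ, _, k2⟩ := eq_root_mul hd0 k1
  have hU0 : U ≠ 0 := by
    intro h
    rw [h, zero_pow hd0.ne'] at u
    have := iota_inj d hd0 (u.trans (map_zero _).symm)
    rw [EmbeddingLike.map_eq_zero_iff] at this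
    have h2 := iota_0 d
    rw [this, map_zero] at h2
    exact pow_ne_zero d (X_ne_zero (R := ℂ) (0 : Fin 2)) h2.symm
  obtain ⟨m, hm⟩ := MvPolynomial.ne_zero_iff.mp hU0
  have hmV : coeff m V ≠ 0 := by
    intro h
    have := congrArg (coeff m) k2
    rw [coeff_map, coeff_C_mul, coeff_C_mul, h] at this
    simp at this
    exact hm this
  obtain ⟨ω, w1, w2, w3, w4⟩ := root_ex hd
  have : ω = ω⁻¹ := by
    rcases hcls with hc | hc
    · exact (coeff_eig (hc ω w1).1 hm).symm.trans (coeff_eig (hc ω w1).2 hmV)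
    · exact (coeff_eig (hc ω w1).2 hmV).symm.trans (coeff_eig (hc ω w1).1 hm)
  apply w3
  rw [sq]
  nth_rewrite 2 [this]
  exact mul_inv_cancel₀ w4

lemma no02 (d : ℕ) (hd : 3 ≤ d) (φ : AQ (surf9 d 0) ≃ₐ[ℝ] AQ (surf9 d 2)) : False := by
  obtain ⟨E, h0, h1, h2⟩ := E0_ex d
  obtain ⟨E', h0', h1', h2'⟩ := E2_ex d
  refine noniso d hd E E' (-1) (by rw [h0, map_neg, map_one]; exact (neg_one_mul (bb d 1)).symm) ?_ φ
  intro i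
  fin_cases i
  exacts [h0', h1', h2']

lemma no12 (d : ℕ) (hd : 3 ≤ d) (φ : AQ (surf9 d 1) ≃ₐ[ℝ] AQ (surf9 d 2)) : False := by
  obtain ⟨E, h0, h1, h2⟩ := E1_ex d
  obtain ⟨E', h0', h1', h2'⟩ := E2_ex d
  refine noniso d hd E E' 1 (by rw [h0, map_one, one_mul]) ?_ φ
  intro i
  fin_cases i
  exacts [h0', h1', h2']

lemma pt0 (d : ℕ) (hd : 0 < d) (he : Even d) (f g : AQ (surf9 d 0) →ₐ[ℝ] ℝ) : f = g := by
  have key : ∀ f : AQ (surf9 d 0) →ₐ[ℝ] ℝ, ∀ i, f (xr _ i) = 0 := by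
    intro f
    have := congrArg f (rel0 d)
    simp only [map_add, map_pow, map_zero] at this
    have p2 := he.pow_nonneg (f (xr (surf9 d 0) 2))
    have p0 := sq_nonneg (f (xr (surf9 d 0) 0))
    have p1 := sq_nonneg (f (xr (surf9 d 0) 1))
    intro i
    fin_cases i
    · have z : f (xr (surf9 d 0) 0) ^ 2 = 0 := by linarith
      exact (pow_eq_zero_iff two_ne_zero).mp z
    · have z : f (xr (surf9 d 0) 1) ^ 2 = 0 := by linarith
      exact (pow_eq_zero_iff two_ne_zero).mp z
    · have z : f (xr (surf9 d 0) 2) ^ d = 0 := by linarith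
      exact (pow_eq_zero_iff hd.ne').mp z
  apply AQ_ext
  intro i
  rw [key f, key g]

lemma no01 (d : ℕ) (hd : 3 ≤ d) (he : Even d) (φ : AQ (surf9 d 0) ≃ₐ[ℝ] AQ (surf9 d 1)) : False := by
  have hd0 : 0 < d := by omega
  obtain ⟨f, hf⟩ := AQ_lift (surf9 d 1) (S := ℝ) ![0,0,0] (by simp [surf9, hd0.ne'])
  obtain ⟨g, hg⟩ := AQ_lift (surf9 d 1) (S := ℝ) ![1,0,1] (by simp [surf9])
  have h := pt0 d hd0 he (f.comp φ) (g.comp φ)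
  have h2 := DFunLike.congr_fun h (φ.symm (xr _ 0))
  simp only [AlgHom.comp_apply] at h2
  have h3 : φ (φ.symm (xr (surf9 d 1) 0)) = xr _ 0 := AlgEquiv.apply_symm_apply _ _
  have h4 : f (xr (surf9 d 1) 0) = g (xr _ 0) := by
    rw [← h3]; exact h2
  rw [hf, hg] at h4
  simp at h4

lemma all_forms (d : ℕ) (hd : 3 ≤ d) (A : Type) [CommRing A] [Algebra ℝ A] (h : Nonempty ((ℂ ⊗[ℝ] A) ≃ₐ[ℂ] BB d)) :
    ∃ i : Fin 3, (1 ≤ i ∨ Even d) ∧ Nonempty (A ≃ₐ[ℝ] AQ (surf9 d i)) := by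
  obtain ⟨e⟩ := h
  obtain ⟨θ, t2, ⟨t0, t1⟩ | ⟨t0, t1⟩ | ⟨he, t0, t1⟩⟩ := classify d hd e
  · obtain ⟨E, h0, h1, h2⟩ := E2_ex d
    obtain ⟨φ⟩ := iso_of_sg E e θ (by
      intro i
      fin_cases i
      · exact t0.trans (congrArg θ h0.symm)
      · exact t1.trans (congrArg θ h1.symm)
      · exact t2.trans (congrArg θ h2.symm))
    exact ⟨2, Or.inl (by decide), ⟨φ.symm⟩⟩
  · obtain ⟨E, h0, h1, h2⟩ := E1_ex d
    obtain ⟨φ⟩ := iso_of_sg E e θ (by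
      intro i
      fin_cases i
      · exact t0.trans (congrArg θ h0.symm)
      · exact t1.trans (congrArg θ h1.symm)
      · exact t2.trans (congrArg θ h2.symm))
    exact ⟨1, Or.inl (by decide), ⟨φ.symm⟩⟩
  · obtain ⟨E, h0, h1, h2⟩ := E0_ex d
    obtain ⟨φ⟩ := iso_of_sg E e θ (by
      intro i
      fin_cases i
      · exact t0.trans (congrArg θ h0.symm)
      · exact t1.trans (congrArg θ h1.symm)
      · exact t2.trans (congrArg θ h2.symm))
    exact ⟨0, Or.inr he, ⟨φ.symm⟩⟩

lemma is_form (d : ℕ) (i : Fin 3) : Nonempty ((ℂ ⊗[ℝ] AQ (surf9 d i)) ≃ₐ[ℂ] BB d) := by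
  fin_cases i
  · exact ⟨(E0_ex d).choose⟩
  · exact ⟨(E1_ex d).choose⟩
  · exact ⟨(E2_ex d).choose⟩

lemma no_iso (d : ℕ) (hd : 3 ≤ d) (i j : Fin 3) (hij : i ≠ j) (h : Even d ∨ (1 ≤ i ∧ 1 ≤ j))
    (φ : AQ (surf9 d i) ≃ₐ[ℝ] AQ (surf9 d j)) : False := by
  fin_cases i <;> fin_cases j
  · exact hij rfl
  · rcases h with h | h
    · exact no01 d hd h φ
    · exact absurd h.1 (by decide)
  · exact no02 d hd φ
  · rcases h with h | h
    · exact no01 d hd h φ.symm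
    · exact absurd h.2 (by decide)
  · exact hij rfl
  · exact no12 d hd φ
  · exact no02 d hd φ.symm
  · exact no12 d hd φ.symm
  · exact hij rfl
end RF

/-- The complex surface `xy = z^d`, `d ≥ 3`, has exactly two isomorphism classes of
real forms when `d` is odd and exactly three when `d` is even. -/
theorem real_forms_of_xy_eq_zd (d : ℕ) (hd : 3 ≤ d) :
    (Odd d →
      (∀ i j : Fin 3, i ≠ j → 1 ≤ i → 1 ≤ j →
        IsEmpty ((MvPolynomial (Fin 3) ℝ ⧸ Ideal.span {surf9 d i}) ≃ₐ[ℝ]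
                 (MvPolynomial (Fin 3) ℝ ⧸ Ideal.span {surf9 d j}))) ∧
      (∀ i : Fin 3, 1 ≤ i →
        IsRealForm (MvPolynomial (Fin 3) ℝ ⧸ Ideal.span {surf9 d i})
          (MvPolynomial (Fin 3) ℂ ⧸
            Ideal.span {(X 0 * X 1 : MvPolynomial (Fin 3) ℂ) - X 2 ^ d})) ∧
      (∀ (A : Type) [CommRing A] [Algebra ℝ A],
        IsRealForm A (MvPolynomial (Fin 3) ℂ ⧸
            Ideal.span {(X 0 * X 1 : MvPolynomial (Fin 3) ℂ) - X 2 ^ d}) →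
        ∃ i : Fin 3, 1 ≤ i ∧
          Nonempty (A ≃ₐ[ℝ] (MvPolynomial (Fin 3) ℝ ⧸ Ideal.span {surf9 d i})))) ∧
    (Even d →
      (∀ i j : Fin 3, i ≠ j →
        IsEmpty ((MvPolynomial (Fin 3) ℝ ⧸ Ideal.span {surf9 d i}) ≃ₐ[ℝ]
                 (MvPolynomial (Fin 3) ℝ ⧸ Ideal.span {surf9 d j}))) ∧
      (∀ i : Fin 3,
        IsRealForm (MvPolynomial (Fin 3) ℝ ⧸ Ideal.span {surf9 d i})
          (MvPolynomial (Fin 3) ℂ ⧸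
            Ideal.span {(X 0 * X 1 : MvPolynomial (Fin 3) ℂ) - X 2 ^ d})) ∧
      (∀ (A : Type) [CommRing A] [Algebra ℝ A],
        IsRealForm A (MvPolynomial (Fin 3) ℂ ⧸
            Ideal.span {(X 0 * X 1 : MvPolynomial (Fin 3) ℂ) - X 2 ^ d}) →
        ∃ i : Fin 3,
          Nonempty (A ≃ₐ[ℝ] (MvPolynomial (Fin 3) ℝ ⧸ Ideal.span {surf9 d i})))) := by
  refine ⟨fun _ho => ⟨fun i j hij hi hj => ⟨fun φ => RF.no_iso d hd i j hij (Or.inr ⟨hi, hj⟩) φ⟩,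
    fun i _ => RF.is_form d i, ?_⟩, fun he => ⟨fun i j hij => ⟨fun φ => RF.no_iso d hd i j hij (Or.inl he) φ⟩,
    fun i => RF.is_form d i, ?_⟩⟩
  · intro A _ _ h
    obtain ⟨i, hi, hA⟩ := RF.all_forms d hd A h
    refine ⟨i, ?_, hA⟩
    rcases hi with hi | hi
    · exact hi
    · exact absurd hi (Nat.not_even_iff_odd.mpr _ho)
  · intro A _ _ h
    obtain ⟨i, _, hA⟩ := RF.all_forms d hd A h
    exact ⟨i, hA⟩
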